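/- arXiv:1304.5292 — 2 statements merged into one kernel-verified Lean document; each statement's English description precedes it below -/
import Mathlib

section
/- Every finite-dimensional real division algebra has dimension 1, 2, 4, or 8. -/
open Filter Topology Module MeasureTheory

section Fredholm

variable {E F : Type*} [NormedAddCommGroup E] [InnerProductSpace ℂ E]
  [NormedAddCommGroup F] [InnerProductSpace ℂ F]

/-- An operator that is bounded below modulo a finite-rank operator has finite-dimensional kernel. -/
theorem finiteDimensional_ker_of_estimate {V : Type*} [NormedAddCommGroup V] [NormedSpace ℂ V]
    [FiniteDimensional ℂ V] (G : E →L[ℂ] F) (p : E →L[ℂ] V) (C : ℝ)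
    (h : ∀ u, ‖u‖ ≤ C * (‖G u‖ + ‖p u‖)) : FiniteDimensional ℂ G.ker := by
  refine FiniteDimensional.of_injective (p.toLinearMap ∘ₗ G.ker.subtype) ?_
  rw [← LinearMap.ker_eq_bot, LinearMap.ker_eq_bot']
  rintro ⟨u, hu⟩ hp
  have hG : G u = 0 := hu
  have hp' : p u = 0 := hp
  have := h u
  rw [hG, hp'] at this
  simpa using this

variable [CompleteSpace E]

/-- An operator that is bounded below modulo a finite-rank operator has closed range. -/
theorem isClosed_range_of_estimate {V : Type*} [NormedAddCommGroup V] [NormedSpace ℂ V]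
    [FiniteDimensional ℂ V] (G : E →L[ℂ] F) (p : E →L[ℂ] V) (C : ℝ)
    (h : ∀ u, ‖u‖ ≤ C * (‖G u‖ + ‖p u‖)) : IsClosed (G.range : Set F) := by
  have hq : FiniteDimensional ℂ (E ⧸ p.ker) :=
    (p.toLinearMap.quotKerEquivRange).symm.finiteDimensional
  have : p.ker.CoFG := hq
  have hc : IsClosed ((p.ker.map G.toLinearMap : Submodule ℂ F) : Set F) := by
    have hker : IsClosed (p.ker : Set E) := p.isClosed_ker
    have : CompleteSpace p.ker := hker.completeSpace_coe
    have hanti : AntilipschitzWith (Real.toNNReal C) (G ∘L p.ker.subtypeL) := by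
      refine ContinuousLinearMap.antilipschitz_of_bound _ ?_
      rintro ⟨u, hu⟩
      have hp : p u = 0 := hu
      have := h u
      rw [hp, norm_zero, add_zero] at this
      refine this.trans ?_
      exact mul_le_mul_of_nonneg_right (Real.le_coe_toNNReal C) (norm_nonneg _)
    have := hanti.isClosed_range (G ∘L p.ker.subtypeL).uniformContinuous
    convert this using 1
    ext y
    simp
  exact LinearMap.isClosed_range_of_isClosed_map_of_finiteDimensional_quotient hc

variable [CompleteSpace F]

/-- The cokernel of an operator with closed range is the kernel of its adjoint. -/
noncomputable def quotientRangeEquivKerAdjoint (G : E →L[ℂ] F)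
    (hG : IsClosed (G.range : Set F)) :
    (F ⧸ G.range) ≃ₗ[ℂ] (ContinuousLinearMap.adjoint G).ker :=
  haveI : CompleteSpace G.range := hG.completeSpace_coe
  (Submodule.quotientEquivOfIsCompl G.range G.rangeᗮ (Submodule.isCompl_orthogonal _)).trans
    (LinearEquiv.ofEq _ _ (ContinuousLinearMap.orthogonal_range G))

/-- The index of a Fredholm operator is locally constant. -/
theorem eventually_index_eq (G₀ : E →L[ℂ] F) [FiniteDimensional ℂ G₀.ker]
    [FiniteDimensional ℂ (F ⧸ G₀.range)] (hG₀ : IsClosed (G₀.range : Set F)) :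
    ∀ᶠ G : E →L[ℂ] F in 𝓝 G₀, FiniteDimensional ℂ G.ker → FiniteDimensional ℂ (F ⧸ G.range) →
      G.toLinearMap.index = G₀.toLinearMap.index := by
  have : CompleteSpace G₀.range := hG₀.completeSpace_coe
  let C := G₀.kerᗮ
  let R := G₀.range
  let pr : F →L[ℂ] R := R.orthogonalProjectionOnto
  let Q : (E →L[ℂ] F) → (C →L[ℂ] R) := fun G => pr ∘L G ∘L C.subtypeL
  have hQ : Continuous Q := by fun_prop
  have hbij : Function.Bijective (Q G₀) := by
    have hval : ∀ x : C, ((Q G₀ x : R) : F) = G₀ x := fun x => by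
      have : G₀ (x : E) ∈ R := ⟨x, rfl⟩
      exact congrArg Subtype.val (Submodule.orthogonalProjectionOnto_mem_subspace_eq_self
        (K := R) ⟨G₀ x, this⟩)
    constructor
    · rw [injective_iff_map_eq_zero]
      intro x hx
      have h1 : G₀ (x : E) = 0 := by rw [← hval, hx]; rfl
      have h2 : (x : E) ∈ G₀.ker := h1
      have := Submodule.inner_left_of_mem_orthogonal h2 x.2
      exact Subtype.ext (inner_self_eq_zero.1 this)
    · rintro ⟨y, ⟨e, rfl⟩⟩
      obtain ⟨a, ha, b, hb, rfl⟩ := G₀.ker.exists_add_mem_mem_orthogonal e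
      refine ⟨⟨b, hb⟩, Subtype.ext ?_⟩
      rw [hval]
      have : G₀ a = 0 := ha
      simp [this]
  let e₀ : C ≃L[ℂ] R := ContinuousLinearEquiv.ofBijective (Q G₀)
    (LinearMap.ker_eq_bot.2 hbij.1) (LinearMap.range_eq_top.2 hbij.2)
  have he₀ : (e₀ : C →L[ℂ] R) = Q G₀ := ContinuousLinearEquiv.coe_ofBijective _ _ _
  have hev : ∀ᶠ G in 𝓝 G₀, Q G ∈ Set.range ((↑) : (C ≃L[ℂ] R) → C →L[ℂ] R) := by
    refine hQ.continuousAt ?_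
    rw [← he₀]
    exact e₀.nhds
  have hCrange : LinearMap.range C.subtype = C := Submodule.range_subtype C
  have fC : FiniteDimensional ℂ (E ⧸ LinearMap.range C.subtype) := by
    rw [hCrange]
    exact ((Submodule.quotientEquivOfIsCompl C G₀.ker
      (Submodule.isCompl_orthogonal _).symm)).symm.finiteDimensional
  have fC' : FiniteDimensional ℂ (LinearMap.ker C.subtype) := by
    rw [Submodule.ker_subtype]; infer_instance
  have fp : FiniteDimensional ℂ (LinearMap.ker pr.toLinearMap) := by
    have : LinearMap.ker pr.toLinearMap = Rᗮ := Submodule.ker_orthogonalProjectionOnto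
    rw [this]
    exact (Submodule.quotientEquivOfIsCompl R Rᗮ (Submodule.isCompl_orthogonal _)).finiteDimensional
  have fp' : FiniteDimensional ℂ (R ⧸ LinearMap.range pr.toLinearMap) := by
    have : LinearMap.range pr.toLinearMap = ⊤ := LinearMap.range_eq_top.2 fun y =>
      ⟨y, Submodule.orthogonalProjectionOnto_mem_subspace_eq_self y⟩
    rw [this]
    infer_instance
  have key : ∀ G : E →L[ℂ] F, Q G ∈ Set.range ((↑) : (C ≃L[ℂ] R) → C →L[ℂ] R) →
      FiniteDimensional ℂ G.ker → FiniteDimensional ℂ (F ⧸ G.range) →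
      0 = pr.toLinearMap.index + (G.toLinearMap.index + C.subtype.index) := by
    rintro G ⟨e, he⟩ f1 f2
    have h0 : (Q G).toLinearMap.index = 0 := by
      rw [← he]
      exact LinearEquiv.index_eq_zero (e := e.toLinearEquiv)
    have f3 : FiniteDimensional ℂ (LinearMap.ker (G.toLinearMap ∘ₗ C.subtype)) := by
      rw [LinearMap.ker_comp]; infer_instance
    have f4 : FiniteDimensional ℂ (F ⧸ LinearMap.range (G.toLinearMap ∘ₗ C.subtype)) := by
      rw [LinearMap.range_comp]; infer_instance
    rw [← h0, ← LinearMap.index_comp, ← LinearMap.index_comp]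
    rfl
  filter_upwards [hev] with G hG f1 f2
  have h1 := key G hG f1 f2
  have h2 := key G₀ ⟨e₀, he₀⟩ inferInstance inferInstance
  linarith

end Fredholm

/-- The weighted pullback `u ↦ (i ↦ w i * u (φ i))` on square-summable families. -/
noncomputable def lpPull {I J : Type*} (φ : I → J) (hφ : Function.Injective φ) (w : I → ℝ)
    (hw : ∀ i, |w i| ≤ 1) :
    lp (fun _ : J => ℂ) 2 →L[ℂ] lp (fun _ : I => ℂ) 2 :=
  have hle : ∀ (u : lp (fun _ : J => ℂ) 2) (i : I),
      ‖(w i : ℂ) * u (φ i)‖ ^ (2 : ENNReal).toReal ≤ ‖u (φ i)‖ ^ (2 : ENNReal).toReal := by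
    intro u i
    refine Real.rpow_le_rpow (norm_nonneg _) ?_ (by simp)
    rw [norm_mul, Complex.norm_real, Real.norm_eq_abs]
    exact mul_le_of_le_one_left (norm_nonneg _) (hw i)
  have hsum : ∀ u : lp (fun _ : J => ℂ) 2,
      Summable fun j => ‖u j‖ ^ (2 : ENNReal).toReal :=
    fun u => (lp.memℓp u).summable (by simp)
  have hsum' : ∀ u : lp (fun _ : J => ℂ) 2,
      Summable fun i => ‖(w i : ℂ) * u (φ i)‖ ^ (2 : ENNReal).toReal := fun u =>
    Summable.of_nonneg_of_le (fun i => by positivity) (hle u) ((hsum u).comp_injective hφ)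
  LinearMap.mkContinuous
    { toFun := fun u => ⟨fun i => (w i : ℂ) * u (φ i), memℓp_gen (hsum' u)⟩
      map_add' := fun u v => by
        ext i
        exact mul_add _ _ _
      map_smul' := fun c u => by
        ext i
        simp [mul_left_comm] } 1 (by
      intro u
      rw [one_mul]
      refine lp.norm_le_of_tsum_le (by simp) (norm_nonneg _) ?_
      rw [lp.norm_rpow_eq_tsum (by simp)]
      exact ((hsum' u).tsum_le_tsum (hle u) ((hsum u).comp_injective hφ)).trans
        (tsum_comp_le_tsum_of_inj (hsum u) (fun j => by positivity) hφ))

@[simp]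
theorem lpPull_apply {I J : Type*} (φ : I → J) (hφ : Function.Injective φ) (w : I → ℝ)
    (hw : ∀ i, |w i| ≤ 1) (u : lp (fun _ : J => ℂ) 2) (i : I) :
    lpPull φ hφ w hw u i = w i * u (φ i) := rfl

theorem lpPull_adjoint_apply {I J : Type*} (φ : I → J) (hφ : Function.Injective φ)
    (w : I → ℝ) (hw : ∀ i, |w i| ≤ 1) (u : lp (fun _ : I => ℂ) 2) (i : I) :
    (lpPull φ hφ w hw).adjoint u (φ i) = w i * u i := by
  classical
  have h1 := lp.inner_single_left (𝕜 := ℂ) (φ i) (1 : ℂ) ((lpPull φ hφ w hw).adjoint u)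
  have h2 : lpPull φ hφ w hw (lp.single 2 (φ i) 1) = lp.single 2 i (w i : ℂ) := by
    ext i'
    by_cases h : i' = i
    · subst h; simp
    · simp [Pi.single_eq_of_ne h, Pi.single_eq_of_ne (hφ.ne h)]
  rw [ContinuousLinearMap.adjoint_inner_right, h2, lp.inner_single_left] at h1
  simp at h1
  rw [← h1, mul_comm]

theorem lpPull_adjoint_apply_eq_zero {I J : Type*} (φ : I → J) (hφ : Function.Injective φ)
    (w : I → ℝ) (hw : ∀ i, |w i| ≤ 1) (u : lp (fun _ : I => ℂ) 2) (j : J)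
    (hj : ∀ i, φ i ≠ j) :
    (lpPull φ hφ w hw).adjoint u j = 0 := by
  classical
  have h1 := lp.inner_single_left (𝕜 := ℂ) j (1 : ℂ) ((lpPull φ hφ w hw).adjoint u)
  have h2 : lpPull φ hφ w hw (lp.single 2 j 1) = 0 := by
    ext i'
    simp [Pi.single_eq_of_ne (hj i')]
  rw [ContinuousLinearMap.adjoint_inner_right, h2, inner_zero_left] at h1
  simpa using h1.symm

section MatrixOperator

variable {H H' : Type*} [NormedAddCommGroup H] [InnerProductSpace ℂ H]
  [NormedAddCommGroup H'] [InnerProductSpace ℂ H'] {ι : Type*} [Fintype ι]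

/-- The operator `A ⊗ S` on finite families of vectors. -/
noncomputable def matOp (A : Matrix ι ι ℂ) (S : H →L[ℂ] H') :
    PiLp 2 (fun _ : ι => H) →L[ℂ] PiLp 2 (fun _ : ι => H') :=
  (PiLp.continuousLinearEquiv 2 ℂ (fun _ : ι => H')).symm.toContinuousLinearMap ∘L
    ContinuousLinearMap.pi fun i => ∑ i', A i i' • (S ∘L PiLp.proj 2 (fun _ : ι => H) i')

@[simp]
theorem matOp_apply (A : Matrix ι ι ℂ) (S : H →L[ℂ] H') (u : PiLp 2 (fun _ : ι => H)) (i : ι) :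
    matOp A S u i = ∑ i', A i i' • S (u i') := by
  simp [matOp]

theorem matOp_add (A B : Matrix ι ι ℂ) (S : H →L[ℂ] H') :
    matOp (A + B) S = matOp A S + matOp B S := by
  ext u i
  simp [add_smul, Finset.sum_add_distrib]

theorem matOp_smul (c : ℂ) (A : Matrix ι ι ℂ) (S : H →L[ℂ] H') :
    matOp (c • A) S = c • matOp A S := by
  ext u i
  simp [Finset.smul_sum, mul_smul]

theorem adjoint_matOp [CompleteSpace H] [CompleteSpace H'] (A : Matrix ι ι ℂ)
    (S : H →L[ℂ] H') : (matOp A S).adjoint = matOp A.conjTranspose S.adjoint := by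
  symm
  rw [ContinuousLinearMap.eq_adjoint_iff]
  intro x y
  simp only [PiLp.inner_apply, matOp_apply, sum_inner, inner_sum, inner_smul_left,
    inner_smul_right, ContinuousLinearMap.adjoint_inner_left, Matrix.conjTranspose_apply]
  rw [Finset.sum_comm]
  simp

end MatrixOperator

/-- Multi-indices whose degree has a given parity. -/
def ParityIndex (k : ℕ) (b : Bool) : Type := {α : Fin k → ℕ // (∑ i, α i).bodd = b}

namespace ParityIndex

variable {k : ℕ} {b c : Bool}

/-- The degree of a multi-index. -/
def degree (α : ParityIndex k b) : ℕ := ∑ i, α.1 i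

/-- Increase the `j`-th entry of a multi-index by one. -/
def raise (h : b ≠ c) (j : Fin k) (α : ParityIndex k b) : ParityIndex k c :=
  ⟨α.1 + Pi.single j 1, by
    have h1 : ∑ i, (α.1 + Pi.single j 1 : Fin k → ℕ) i = (∑ i, α.1 i) + 1 := by
      simp [Finset.sum_add_distrib]
    rw [h1, Nat.bodd_succ, α.2]
    revert h
    cases b <;> cases c <;> simp⟩

theorem degree_raise (h : b ≠ c) (j : Fin k) (α : ParityIndex k b) :
    (raise h j α).degree = α.degree + 1 := by
  simp [degree, raise, Finset.sum_add_distrib]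

theorem raise_injective (h : b ≠ c) (j : Fin k) :
    Function.Injective (raise h j : ParityIndex k b → ParityIndex k c) := by
  intro α β hαβ
  have := congrArg Subtype.val hαβ
  exact Subtype.ext (add_right_cancel this)

theorem raise_apply_pos (h : b ≠ c) (j : Fin k) (α : ParityIndex k b) :
    0 < (raise h j α).1 j := by
  simp [raise]

theorem exists_raise_eq (h : b ≠ c) (j : Fin k) (β : ParityIndex k c) (hβ : 0 < β.1 j) :
    ∃ α : ParityIndex k b, raise h j α = β := by
  have h1 : β.1 - Pi.single j 1 + Pi.single j 1 = β.1 := by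
    funext i
    by_cases hi : i = j
    · subst hi; simp; omega
    · simp [Pi.single_eq_of_ne hi]
  have h2 : (∑ i, β.1 i) = (∑ i, (β.1 - Pi.single j 1 : Fin k → ℕ) i) + 1 := by
    conv_lhs => rw [← h1]
    simp [Finset.sum_add_distrib]
  refine ⟨⟨β.1 - Pi.single j 1, ?_⟩, Subtype.ext h1⟩
  have h3 := β.2
  rw [h2, Nat.bodd_succ] at h3
  revert h h3
  cases (∑ i, (β.1 - Pi.single j 1 : Fin k → ℕ) i).bodd <;> cases b <;> cases c <;> simp

theorem apply_le_degree (α : ParityIndex k b) (j : Fin k) : α.1 j ≤ α.degree :=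
  Finset.single_le_sum (f := α.1) (fun _ _ => Nat.zero_le _) (Finset.mem_univ j)

theorem finite_degree_lt (k : ℕ) (b : Bool) (d : ℕ) :
    {α : ParityIndex k b | α.degree < d}.Finite := by
  have h : (Set.Iic (fun _ : Fin k => d)).Finite := Set.finite_Iic _
  refine Set.Finite.of_finite_image (f := Subtype.val) (h.subset ?_) Subtype.val_injective.injOn
  rintro _ ⟨α, hα, rfl⟩ i
  exact (apply_le_degree α i).trans (le_of_lt hα)

end ParityIndex

open ParityIndex

/-- Square-summable families indexed by multi-indices of a given parity. -/
abbrev FockSpace (k : ℕ) (b : Bool) : Type := lp (fun _ : ParityIndex k b => ℂ) 2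

/-- Families of vectors of the Fock space. -/
abbrev FockPow (k : ℕ) (b : Bool) (ι : Type*) : Type _ := PiLp 2 (fun _ : ι => FockSpace k b)

section Shift

variable {k : ℕ} {b c : Bool}

/-- The weight of the shift operators. -/
noncomputable def shiftWeight (j : Fin k) (α : ParityIndex k b) : ℝ :=
  √((α.1 j + 1) / (α.degree + 1))

theorem abs_shiftWeight_le (j : Fin k) (α : ParityIndex k b) : |shiftWeight j α| ≤ 1 := by
  rw [shiftWeight, abs_of_nonneg (Real.sqrt_nonneg _)]
  refine Real.sqrt_le_one.mpr ?_
  rw [div_le_one (by positivity)]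
  have : (α.1 j : ℝ) ≤ α.degree := by exact_mod_cast apply_le_degree α j
  linarith

/-- The lowering operator of the `j`-th variable. -/
noncomputable def lowerOp (h : b ≠ c) (j : Fin k) : FockSpace k c →L[ℂ] FockSpace k b :=
  lpPull (raise h j) (raise_injective h j) (shiftWeight j) (abs_shiftWeight_le j)

/-- The raising operator of the `j`-th variable. -/
noncomputable def raiseOp (h : b ≠ c) (j : Fin k) : FockSpace k b →L[ℂ] FockSpace k c :=
  (lowerOp h j).adjoint

theorem lowerOp_apply (h : b ≠ c) (j : Fin k) (u : FockSpace k c) (α : ParityIndex k b) :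
    lowerOp h j u α = shiftWeight j α * u (raise h j α) := rfl

theorem raiseOp_apply_raise (h : b ≠ c) (j : Fin k) (u : FockSpace k b) (α : ParityIndex k b) :
    raiseOp h j u (raise h j α) = shiftWeight j α * u α :=
  lpPull_adjoint_apply _ _ _ _ _ _

theorem raiseOp_apply_eq_zero (h : b ≠ c) (j : Fin k) (u : FockSpace k b) (β : ParityIndex k c)
    (hβ : β.1 j = 0) : raiseOp h j u β = 0 := by
  refine lpPull_adjoint_apply_eq_zero _ _ _ _ _ _ fun α hα => ?_
  have := raise_apply_pos h j α
  rw [hα] at this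
  omega

/-- The diagonal operator with entries `1 / √(|α| + 1)`. -/
noncomputable def dampOp (k : ℕ) (b : Bool) : FockSpace k b →L[ℂ] FockSpace k b :=
  lpPull id Function.injective_id (fun α => (√(α.degree + 1))⁻¹) fun α => by
    rw [abs_of_nonneg (by positivity)]
    refine inv_le_one_of_one_le₀ ?_
    rw [Real.one_le_sqrt]
    simp

theorem dampOp_apply (u : FockSpace k b) (α : ParityIndex k b) :
    dampOp k b u α = ((√(α.degree + 1))⁻¹ : ℝ) * u α := rfl

theorem sq_norm_le_sum_raiseOp (hk : 1 ≤ k) (h : b ≠ c) (u : FockSpace k b) :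
    ‖u‖ ^ 2 ≤ ∑ j, ‖raiseOp h j u‖ ^ 2 := by
  have h1 : ∀ j, HasSum (fun α => shiftWeight j α ^ 2 * ‖u α‖ ^ 2) (‖raiseOp h j u‖ ^ 2) := by
    intro j
    have h2 := (lp.hasSum_inner (𝕜 := ℂ) u (lowerOp h j (raiseOp h j u))).mapL Complex.reCLM
    have h3 : Complex.reCLM (inner ℂ u (lowerOp h j (raiseOp h j u))) =
        ‖raiseOp h j u‖ ^ 2 := by
      rw [← ContinuousLinearMap.adjoint_inner_left]
      change Complex.re (inner ℂ (raiseOp h j u) (raiseOp h j u)) = _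
      rw [inner_self_eq_norm_sq_to_K]
      norm_cast
    rw [h3] at h2
    refine h2.congr_fun ?_
    intro α
    simp only [lowerOp_apply, raiseOp_apply_raise]
    simp [Complex.sq_norm, Complex.normSq_apply]
    ring
  have h4 := hasSum_sum (s := Finset.univ) fun j _ => h1 j
  have h5 : HasSum (fun α => ‖u α‖ ^ 2) (‖u‖ ^ 2) := by
    have := lp.hasSum_norm (p := 2) (by simp) u
    simpa using this
  refine hasSum_le (fun α => ?_) h5 h4
  rw [← Finset.sum_mul]
  refine le_mul_of_one_le_left (by positivity) ?_
  have h6 : ∀ j : Fin k, shiftWeight j α ^ 2 = ((α.1 j : ℝ) + 1) / (α.degree + 1) := fun j =>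
    Real.sq_sqrt (by positivity)
  simp_rw [h6]
  rw [← Finset.sum_div, one_le_div (by positivity), Finset.sum_add_distrib]
  have : (1 : ℝ) ≤ k := by exact_mod_cast hk
  simp [degree]
  linarith

end Shift

/-- Pairs of families of coefficient matrices, encoding `∑ v_j A_j + conj v_j B_j`. -/
abbrev RealSymbol (k : ℕ) (ι : Type*) : Type _ :=
  (Fin k → Matrix ι ι ℂ) × (Fin k → Matrix ι ι ℂ)

namespace RealSymbol

variable {k : ℕ} {ι : Type*}

/-- The value of a symbol at a vector. -/
noncomputable def eval (f : RealSymbol k ι) (v : Fin k → ℂ) : Matrix ι ι ℂ :=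
  ∑ j, (v j • f.1 j + starRingEnd ℂ (v j) • f.2 j)

/-- The pointwise conjugate transpose of a symbol. -/
def conj (f : RealSymbol k ι) : RealSymbol k ι :=
  (fun j => (f.2 j).conjTranspose, fun j => (f.1 j).conjTranspose)

theorem conj_conj (f : RealSymbol k ι) : f.conj.conj = f := by
  simp [conj]

theorem eval_conj (f : RealSymbol k ι) (v : Fin k → ℂ) :
    f.conj.eval v = (f.eval v).conjTranspose := by
  simp [eval, conj, Matrix.conjTranspose_sum, add_comm]

/-- A symbol is elliptic if it is invertible away from the origin. -/
def IsElliptic [Fintype ι] (f : RealSymbol k ι) : Prop :=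
  ∀ v : Fin k → ℂ, v ≠ 0 → ∀ x : ι → ℂ, (f.eval v).mulVec x = 0 → x = 0

theorem IsElliptic.conj [Fintype ι] {f : RealSymbol k ι} (hf : f.IsElliptic) :
    f.conj.IsElliptic := by
  classical
  intro v hv x hx
  rw [eval_conj] at hx
  by_contra hx0
  have h1 : (f.eval v).conjTranspose.det = 0 := Matrix.exists_mulVec_eq_zero_iff.mp ⟨x, hx0, hx⟩
  rw [Matrix.det_conjTranspose, star_eq_zero] at h1
  obtain ⟨y, hy0, hy⟩ := Matrix.exists_mulVec_eq_zero_iff.mpr h1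
  exact hy0 (hf v hv y hy)

variable [Fintype ι] {b c : Bool}

/-- The Toeplitz-type operator associated with a symbol. -/
noncomputable def toOp (h : b ≠ c) (f : RealSymbol k ι) : FockPow k b ι →L[ℂ] FockPow k c ι :=
  ∑ j, (matOp (f.1 j) (raiseOp h j) + matOp (f.2 j) (lowerOp h.symm j))

theorem toOp_apply (h : b ≠ c) (f : RealSymbol k ι) (u : FockPow k b ι) (i : ι) :
    f.toOp h u i = ∑ j, ((∑ i', f.1 j i i' • raiseOp h j (u i')) +
      ∑ i', f.2 j i i' • lowerOp h.symm j (u i')) := by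
  simp [toOp]

theorem adjoint_toOp (h : b ≠ c) (f : RealSymbol k ι) :
    (f.toOp h).adjoint = f.conj.toOp h.symm := by
  simp only [toOp, map_sum, map_add, adjoint_matOp, conj, raiseOp,
    ContinuousLinearMap.adjoint_adjoint, add_comm]

theorem toOp_add (h : b ≠ c) (f g : RealSymbol k ι) : (f + g).toOp h = f.toOp h + g.toOp h := by
  simp only [toOp, Prod.fst_add, Prod.snd_add, Pi.add_apply, matOp_add, ← Finset.sum_add_distrib]
  refine Finset.sum_congr rfl fun j _ => ?_
  abel

theorem toOp_smul (h : b ≠ c) (a : ℂ) (f : RealSymbol k ι) : (a • f).toOp h = a • f.toOp h := by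
  simp only [toOp, Prod.smul_fst, Prod.smul_snd, Pi.smul_apply, matOp_smul, smul_add,
    Finset.smul_sum]

end RealSymbol

theorem integrable_norm_pow_mul_exp (n : ℕ) :
    Integrable fun z : ℂ => ‖z‖ ^ n * Real.exp (-‖z‖ ^ 2) := by
  have h := Complex.integral_rpow_mul_exp_neg_rpow (p := 2) (q := n) (by norm_num)
    (by have : (0 : ℝ) ≤ n := Nat.cast_nonneg n
        linarith)
  refine Integrable.of_integral_ne_zero ?_
  have h' : ∫ z : ℂ, ‖z‖ ^ n * Real.exp (-‖z‖ ^ 2) =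
      2 * Real.pi / 2 * Real.Gamma ((n + 2) / 2) := by
    rw [← h]
    refine integral_congr_ae (Eventually.of_forall fun z => ?_)
    simp only [Real.rpow_natCast, Real.rpow_two]
  rw [h']
  have := Real.Gamma_pos_of_pos (s := ((n : ℝ) + 2) / 2) (by positivity)
  have := Real.pi_pos
  positivity

theorem integral_conj_pow_mul_pow_mul_exp (m n : ℕ) :
    ∫ z : ℂ, (starRingEnd ℂ z) ^ m * z ^ n * (Real.exp (-‖z‖ ^ 2) : ℂ) =
      if m = n then (Real.pi * n.factorial : ℂ) else 0 := by
  split_ifs with hmn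
  · subst hmn
    have h := Complex.integral_rpow_mul_exp_neg_rpow (p := 2) (q := 2 * m) (by norm_num)
      (by have : (0 : ℝ) ≤ m := Nat.cast_nonneg m
          linarith)
    have h1 : ∀ z : ℂ, (starRingEnd ℂ z) ^ m * z ^ m * (Real.exp (-‖z‖ ^ 2) : ℂ) =
        ((‖z‖ ^ (2 * m : ℝ) * Real.exp (-‖z‖ ^ (2 : ℝ)) : ℝ) : ℂ) := by
      intro z
      rw [← mul_pow, mul_comm (starRingEnd ℂ z), Complex.mul_conj, Complex.normSq_eq_norm_sq,
        Real.rpow_mul (norm_nonneg _)]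
      push_cast
      simp
    simp_rw [h1]
    rw [integral_complex_ofReal, h]
    have h2 : (2 * (m : ℝ) + 2) / 2 = m + 1 := by ring
    rw [h2, Real.Gamma_nat_eq_factorial]
    push_cast
    ring
  · set f : ℂ → ℂ := fun z => (starRingEnd ℂ z) ^ m * z ^ n * (Real.exp (-‖z‖ ^ 2) : ℂ) with hf
    have hd : (n : ℝ) - m ≠ 0 := by
      intro h
      apply hmn
      have : (n : ℝ) = m := by linarith
      exact_mod_cast this.symm
    set t : ℝ := Real.pi / (n - m) with ht
    have hrot : ∀ z, f (rotation (Circle.exp t) z) = - f z := by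
      intro z
      have h3 : (starRingEnd ℂ (Circle.exp t : ℂ)) ^ m * (Circle.exp t : ℂ) ^ n = -1 := by
        rw [Circle.coe_exp, ← Complex.exp_conj, ← Complex.exp_nat_mul, ← Complex.exp_nat_mul,
          ← Complex.exp_add, ← Complex.exp_pi_mul_I]
        congr 1
        simp only [map_mul, Complex.conj_ofReal, Complex.conj_I]
        have : (Real.pi : ℂ) = (n - m) * t := by
          rw [ht]
          have : ((n : ℂ) - m) ≠ 0 := by exact_mod_cast hd
          push_cast
          field_simp
        rw [this]
        ring
      simp only [hf, rotation_apply, map_mul, norm_mul, Circle.norm_coe, one_mul, mul_pow]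
      calc _ = ((starRingEnd ℂ (Circle.exp t : ℂ)) ^ m * (Circle.exp t : ℂ) ^ n) *
            ((starRingEnd ℂ z) ^ m * z ^ n * (Real.exp (-‖z‖ ^ 2) : ℂ)) := by ring
        _ = _ := by rw [h3]; ring
    have h4 := (rotation (Circle.exp t)).measurePreserving.integral_comp
      (rotation (Circle.exp t)).toHomeomorph.measurableEmbedding f
    simp_rw [hrot, integral_neg] at h4
    have : (2 : ℂ) * ∫ z, f z = 0 := by linear_combination -h4
    simpa using this

/-- The normalized weighted monomials of one complex variable. -/
noncomputable def gaussMonomial (n : ℕ) (z : ℂ) : ℂ :=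
  z ^ n * (Real.exp (-‖z‖ ^ 2 / 2) : ℂ) * ((√(Real.pi * n.factorial))⁻¹ : ℝ)

theorem continuous_gaussMonomial (n : ℕ) : Continuous (gaussMonomial n) := by
  unfold gaussMonomial
  fun_prop

theorem conj_gaussMonomial_mul (m n : ℕ) (z : ℂ) :
    starRingEnd ℂ (gaussMonomial m z) * gaussMonomial n z =
      ((starRingEnd ℂ z) ^ m * z ^ n * (Real.exp (-‖z‖ ^ 2) : ℂ)) *
        (((√(Real.pi * m.factorial))⁻¹ * (√(Real.pi * n.factorial))⁻¹ : ℝ) : ℂ) := by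
  have h : Real.exp (-‖z‖ ^ 2) = Real.exp (-‖z‖ ^ 2 / 2) * Real.exp (-‖z‖ ^ 2 / 2) := by
    rw [← Real.exp_add]
    congr 1
    ring
  rw [h]
  simp only [gaussMonomial, map_mul, map_pow, Complex.conj_ofReal]
  push_cast
  ring

theorem integrable_conj_gaussMonomial_mul (m n : ℕ) :
    Integrable fun z => starRingEnd ℂ (gaussMonomial m z) * gaussMonomial n z := by
  simp_rw [conj_gaussMonomial_mul]
  refine Integrable.mul_const ?_ _
  refine (integrable_norm_pow_mul_exp (m + n)).mono' ?_ ?_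
  · exact Continuous.aestronglyMeasurable (by fun_prop)
  · refine Eventually.of_forall fun z => le_of_eq ?_
    rw [norm_mul, norm_mul, norm_pow, norm_pow, RCLike.norm_conj, Complex.norm_real, pow_add,
      Real.norm_of_nonneg (Real.exp_pos _).le]

theorem integral_conj_gaussMonomial_mul (m n : ℕ) :
    ∫ z, starRingEnd ℂ (gaussMonomial m z) * gaussMonomial n z = if m = n then 1 else 0 := by
  simp_rw [conj_gaussMonomial_mul]
  rw [integral_mul_const, integral_conj_pow_mul_pow_mul_exp]
  split_ifs with h
  · subst h
    have h1 : (0 : ℝ) < Real.pi * m.factorial := by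
      have := Real.pi_pos
      positivity
    rw [← mul_inv, Real.mul_self_sqrt h1.le]
    push_cast
    refine mul_inv_cancel₀ ?_
    exact_mod_cast h1.ne'
  · simp

theorem self_mul_gaussMonomial (n : ℕ) (z : ℂ) :
    z * gaussMonomial n z = (√(n + 1) : ℝ) * gaussMonomial (n + 1) z := by
  have h0 : (√((n : ℝ) + 1) : ℝ) ≠ 0 := by positivity
  have h : (√(Real.pi * n.factorial))⁻¹ = √(n + 1) * (√(Real.pi * (n + 1).factorial))⁻¹ := by
    rw [Nat.factorial_succ]
    push_cast
    rw [show Real.pi * (((n : ℝ) + 1) * n.factorial) = (n + 1) * (Real.pi * n.factorial) by ring,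
      Real.sqrt_mul (x := (n : ℝ) + 1) (by positivity), mul_inv, ← mul_assoc,
      mul_inv_cancel₀ h0, one_mul]
  simp only [gaussMonomial]
  rw [h]
  push_cast
  ring

/-- The part of `conj z` times a weighted monomial orthogonal to the holomorphic part. -/
noncomputable def gaussConjMonomial (n : ℕ) (z : ℂ) : ℂ :=
  starRingEnd ℂ z * gaussMonomial n z - (√n : ℝ) * gaussMonomial (n - 1) z

theorem continuous_gaussConjMonomial (n : ℕ) : Continuous (gaussConjMonomial n) := by
  have h1 := continuous_gaussMonomial n
  have h2 := continuous_gaussMonomial (n - 1)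
  unfold gaussConjMonomial
  fun_prop

theorem sqrt_mul_self_mul_gaussMonomial_pred (n : ℕ) (z : ℂ) :
    (√n : ℝ) * (z * gaussMonomial (n - 1) z) = n * gaussMonomial n z := by
  cases n with
  | zero => simp
  | succ n =>
    rw [Nat.add_sub_cancel, self_mul_gaussMonomial, ← mul_assoc, ← Complex.ofReal_mul]
    push_cast
    rw [← Complex.ofReal_mul, Real.mul_self_sqrt (by positivity)]
    push_cast
    ring

theorem conj_gaussConjMonomial_mul (m n : ℕ) (z : ℂ) :
    starRingEnd ℂ (gaussConjMonomial m z) * gaussConjMonomial n z =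
      (√(m + 1) * √(n + 1) : ℝ) *
          (starRingEnd ℂ (gaussMonomial (m + 1) z) * gaussMonomial (n + 1) z) -
        (m + n : ℝ) * (starRingEnd ℂ (gaussMonomial m z) * gaussMonomial n z) +
        (√m * √n : ℝ) *
          (starRingEnd ℂ (gaussMonomial (m - 1) z) * gaussMonomial (n - 1) z) := by
  have h1 := self_mul_gaussMonomial n z
  have h2 := congrArg (starRingEnd ℂ) (self_mul_gaussMonomial m z)
  have h3 := sqrt_mul_self_mul_gaussMonomial_pred n z
  have h4 := congrArg (starRingEnd ℂ) (sqrt_mul_self_mul_gaussMonomial_pred m z)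
  simp only [map_mul, Complex.conj_ofReal, map_natCast] at h2 h4
  simp only [gaussConjMonomial, map_sub, map_mul, Complex.conj_ofReal, Complex.conj_conj]
  push_cast
  linear_combination (starRingEnd ℂ z * starRingEnd ℂ (gaussMonomial m z)) * h1 +
    (√(n + 1) : ℝ) * gaussMonomial (n + 1) z * h2 - starRingEnd ℂ (gaussMonomial m z) * h3 -
    gaussMonomial n z * h4

theorem integrable_conj_gaussConjMonomial_mul (m n : ℕ) :
    Integrable fun z => starRingEnd ℂ (gaussConjMonomial m z) * gaussConjMonomial n z := by
  simp_rw [conj_gaussConjMonomial_mul]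
  exact (((integrable_conj_gaussMonomial_mul _ _).const_mul _).sub
    ((integrable_conj_gaussMonomial_mul _ _).const_mul _)).add
    ((integrable_conj_gaussMonomial_mul _ _).const_mul _)

theorem integral_conj_gaussConjMonomial_mul (m n : ℕ) :
    ∫ z, starRingEnd ℂ (gaussConjMonomial m z) * gaussConjMonomial n z =
      if m = n then 1 else 0 := by
  simp_rw [conj_gaussConjMonomial_mul]
  rw [integral_add, integral_sub, integral_const_mul, integral_const_mul, integral_const_mul,
    integral_conj_gaussMonomial_mul, integral_conj_gaussMonomial_mul,
    integral_conj_gaussMonomial_mul]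
  · by_cases h : m = n
    · subst h
      simp only [if_true, mul_one]
      rw [Real.mul_self_sqrt (by positivity), Real.mul_self_sqrt (by positivity)]
      push_cast
      ring
    · rcases m with _ | m <;> rcases n with _ | n <;> simp_all
  · exact (integrable_conj_gaussMonomial_mul _ _).const_mul _
  · exact (integrable_conj_gaussMonomial_mul _ _).const_mul _
  · exact ((integrable_conj_gaussMonomial_mul _ _).const_mul _).sub
      ((integrable_conj_gaussMonomial_mul _ _).const_mul _)
  · exact (integrable_conj_gaussMonomial_mul _ _).const_mul _

/-- Square-integrable functions on `ℂ^k`. -/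
abbrev SquareIntegrable (k : ℕ) : Type := Lp ℂ 2 (volume : Measure (Fin k → ℂ))

section Product

variable {k : ℕ} {g : Fin k → ℕ → ℂ → ℂ}

theorem memLp_prod (hc : ∀ i n, Continuous (g i n))
    (hi : ∀ i m n, Integrable fun z => starRingEnd ℂ (g i m z) * g i n z) (α : Fin k → ℕ) :
    MemLp (fun z : Fin k → ℂ => ∏ i, g i (α i) (z i)) 2 := by
  rw [memLp_two_iff_integrable_sq_norm]
  · have h := (Integrable.fintype_prod (f := fun i => fun z : ℂ =>
      starRingEnd ℂ (g i (α i) z) * g i (α i) z) (μ := fun _ => volume) fun i => hi i _ _).norm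
    refine h.congr (Eventually.of_forall fun z => ?_)
    simp [norm_prod, ← sq, Finset.prod_mul_distrib]
  · exact Continuous.aestronglyMeasurable (by fun_prop)

theorem orthonormal_prod (hc : ∀ i n, Continuous (g i n))
    (hi : ∀ i m n, Integrable fun z => starRingEnd ℂ (g i m z) * g i n z)
    (ho : ∀ i m n, ∫ z, starRingEnd ℂ (g i m z) * g i n z = if m = n then 1 else 0) :
    Orthonormal ℂ fun α : Fin k → ℕ => ((memLp_prod hc hi α).toLp _ : SquareIntegrable k) := by
  classical
  rw [orthonormal_iff_ite]
  intro α β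
  rw [L2.inner_def]
  have h1 : ∫ z, inner ℂ (((memLp_prod hc hi α).toLp _ : SquareIntegrable k) z)
      (((memLp_prod hc hi β).toLp _ : SquareIntegrable k) z) =
      ∫ z : Fin k → ℂ, ∏ i, (starRingEnd ℂ (g i (α i) (z i)) * g i (β i) (z i)) := by
    refine integral_congr_ae ?_
    filter_upwards [(memLp_prod hc hi α).coeFn_toLp, (memLp_prod hc hi β).coeFn_toLp]
      with z hz1 hz2
    rw [hz1, hz2, RCLike.inner_apply, map_prod, Finset.prod_mul_distrib, mul_comm]
  rw [h1, integral_fintype_prod_volume_eq_prod fun i z =>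
    starRingEnd ℂ (g i (α i) z) * g i (β i) z]
  simp_rw [ho]
  by_cases h : α = β
  · subst h; simp
  · rw [if_neg h]
    obtain ⟨i, hi⟩ := Function.ne_iff.mp h
    exact Finset.prod_eq_zero (Finset.mem_univ i) (if_neg hi)

end Product

section Single

variable {I J : Type*} [DecidableEq J]

theorem lpPull_single [DecidableEq I] (φ : I → J) (hφ : Function.Injective φ) (w : I → ℝ)
    (hw : ∀ i, |w i| ≤ 1) (i : I) (a : ℂ) :
    lpPull φ hφ w hw (lp.single 2 (φ i) a) = lp.single 2 i (w i * a) := by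
  ext i'
  by_cases h : i' = i
  · subst h; simp
  · simp [Pi.single_eq_of_ne h, Pi.single_eq_of_ne (hφ.ne h)]

theorem lpPull_single_of_ne (φ : I → J) (hφ : Function.Injective φ) (w : I → ℝ)
    (hw : ∀ i, |w i| ≤ 1) (j : J) (hj : ∀ i, φ i ≠ j) (a : ℂ) :
    lpPull φ hφ w hw (lp.single 2 j a) = 0 := by
  ext i'
  simp [Pi.single_eq_of_ne (hj i')]

theorem lpPull_adjoint_single [DecidableEq I] (φ : I → J) (hφ : Function.Injective φ) (w : I → ℝ)
    (hw : ∀ i, |w i| ≤ 1) (i : I) (a : ℂ) :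
    (lpPull φ hφ w hw).adjoint (lp.single 2 i a) = lp.single 2 (φ i) (w i * a) := by
  ext j
  by_cases hj : ∃ i', φ i' = j
  · obtain ⟨i', rfl⟩ := hj
    rw [lpPull_adjoint_apply]
    by_cases h : i' = i
    · subst h; simp
    · simp [Pi.single_eq_of_ne h, Pi.single_eq_of_ne (hφ.ne h)]
  · push Not at hj
    rw [lpPull_adjoint_apply_eq_zero _ _ _ _ _ _ hj]
    simp [Pi.single_eq_of_ne (hj i).symm]

end Single

/-- The isometry from square-summable families determined by an orthonormal family. -/
noncomputable def Orthonormal.lpIsometry {I E : Type*} [NormedAddCommGroup E]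
    [InnerProductSpace ℂ E] [CompleteSpace E] {v : I → E} (hv : Orthonormal ℂ v) :
    lp (fun _ : I => ℂ) 2 →ₗᵢ[ℂ] E :=
  hv.orthogonalFamily.linearIsometry

theorem Orthonormal.lpIsometry_single {I E : Type*} [DecidableEq I] [NormedAddCommGroup E]
    [InnerProductSpace ℂ E] [CompleteSpace E] {v : I → E} (hv : Orthonormal ℂ v) (i : I) (a : ℂ) :
    hv.lpIsometry (lp.single 2 i a) = a • v i := by
  simp [Orthonormal.lpIsometry, OrthogonalFamily.linearIsometry_apply_single]

section GaussVectors

variable {k : ℕ}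

/-- The normalized weighted monomials on `ℂ^k`. -/
noncomputable def gaussFun (α : Fin k → ℕ) (z : Fin k → ℂ) : ℂ := ∏ i, gaussMonomial (α i) (z i)

/-- The factors of the product `gaussConjFun`. -/
noncomputable def gaussConjFactor (j i : Fin k) : ℕ → ℂ → ℂ :=
  if i = j then gaussConjMonomial else gaussMonomial

theorem continuous_gaussConjFactor (j i : Fin k) (n : ℕ) : Continuous (gaussConjFactor j i n) := by
  rw [gaussConjFactor]
  split_ifs
  exacts [continuous_gaussConjMonomial n, continuous_gaussMonomial n]

theorem integrable_conj_gaussConjFactor_mul (j i : Fin k) (m n : ℕ) :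
    Integrable fun z => starRingEnd ℂ (gaussConjFactor j i m z) * gaussConjFactor j i n z := by
  rw [gaussConjFactor]
  split_ifs
  exacts [integrable_conj_gaussConjMonomial_mul m n, integrable_conj_gaussMonomial_mul m n]

theorem integral_conj_gaussConjFactor_mul (j i : Fin k) (m n : ℕ) :
    ∫ z, starRingEnd ℂ (gaussConjFactor j i m z) * gaussConjFactor j i n z =
      if m = n then 1 else 0 := by
  by_cases hi : i = j
  · simpa only [gaussConjFactor, if_pos hi] using integral_conj_gaussConjMonomial_mul m n
  · simpa only [gaussConjFactor, if_neg hi] using integral_conj_gaussMonomial_mul m n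

/-- The product of the weighted monomials, with the `j`-th factor replaced by the orthogonal part of
its product with `conj z`. -/
noncomputable def gaussConjFun (j : Fin k) (α : Fin k → ℕ) (z : Fin k → ℂ) : ℂ :=
  ∏ i, gaussConjFactor j i (α i) (z i)

theorem gaussFun_eq_mul (j : Fin k) (α : Fin k → ℕ) (z : Fin k → ℂ) :
    gaussFun α z = gaussMonomial (α j) (z j) *
      ∏ i ∈ Finset.univ.erase j, gaussMonomial (α i) (z i) :=
  (Finset.mul_prod_erase _ _ (Finset.mem_univ j)).symm

theorem prod_erase_gaussMonomial_congr (j : Fin k) {α β : Fin k → ℕ} (h : ∀ i ≠ j, α i = β i)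
    (z : Fin k → ℂ) : ∏ i ∈ Finset.univ.erase j, gaussMonomial (α i) (z i) =
      ∏ i ∈ Finset.univ.erase j, gaussMonomial (β i) (z i) :=
  Finset.prod_congr rfl fun i hi => by rw [h i (Finset.ne_of_mem_erase hi)]

theorem self_mul_gaussFun (j : Fin k) (α : Fin k → ℕ) (z : Fin k → ℂ) :
    z j * gaussFun α z = (√(α j + 1) : ℝ) * gaussFun (α + Pi.single j 1) z := by
  rw [gaussFun_eq_mul j, gaussFun_eq_mul j, ← mul_assoc, self_mul_gaussMonomial,
    prod_erase_gaussMonomial_congr j (β := α + Pi.single j 1)]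
  · simp [mul_assoc]
  · intro i hi
    simp [Pi.single_eq_of_ne hi]

theorem gaussConjFun_eq_mul (j : Fin k) (α : Fin k → ℕ) (z : Fin k → ℂ) :
    gaussConjFun j α z = gaussConjMonomial (α j) (z j) *
      ∏ i ∈ Finset.univ.erase j, gaussMonomial (α i) (z i) := by
  rw [gaussConjFun, ← Finset.mul_prod_erase _ _ (Finset.mem_univ j), gaussConjFactor,
    if_pos rfl]
  congr 1
  exact Finset.prod_congr rfl fun i hi => by rw [gaussConjFactor, if_neg (Finset.ne_of_mem_erase hi)]

theorem conj_mul_gaussFun_raise (j : Fin k) (α : Fin k → ℕ) (z : Fin k → ℂ) :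
    starRingEnd ℂ (z j) * gaussFun (α + Pi.single j 1) z =
      gaussConjFun j (α + Pi.single j 1) z + (√(α j + 1) : ℝ) * gaussFun α z := by
  rw [gaussFun_eq_mul j, gaussFun_eq_mul j α, gaussConjFun_eq_mul,
    prod_erase_gaussMonomial_congr j (α := α) (β := α + Pi.single j 1)]
  · simp only [gaussConjMonomial, Pi.add_apply, Pi.single_eq_same, Nat.add_sub_cancel]
    push_cast
    ring
  · intro i hi
    simp [Pi.single_eq_of_ne hi]

theorem conj_mul_gaussFun_of_eq_zero (j : Fin k) (α : Fin k → ℕ) (hα : α j = 0)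
    (z : Fin k → ℂ) : starRingEnd ℂ (z j) * gaussFun α z = gaussConjFun j α z := by
  rw [gaussFun_eq_mul j, gaussConjFun_eq_mul, gaussConjMonomial, hα]
  simp [mul_assoc]

theorem memLp_gaussFun (α : Fin k → ℕ) : MemLp (gaussFun α) 2 :=
  memLp_prod (g := fun _ => gaussMonomial) (fun _ => continuous_gaussMonomial)
    (fun _ => integrable_conj_gaussMonomial_mul) α

theorem memLp_gaussConjFun (j : Fin k) (α : Fin k → ℕ) : MemLp (gaussConjFun j α) 2 :=
  memLp_prod (continuous_gaussConjFactor j) (integrable_conj_gaussConjFactor_mul j) α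

theorem orthonormal_gaussFun :
    Orthonormal ℂ fun α : Fin k → ℕ => ((memLp_gaussFun α).toLp _ : SquareIntegrable k) :=
  orthonormal_prod (g := fun _ => gaussMonomial) (fun _ => continuous_gaussMonomial)
    (fun _ => integrable_conj_gaussMonomial_mul) fun _ => integral_conj_gaussMonomial_mul

theorem orthonormal_gaussConjFun (j : Fin k) :
    Orthonormal ℂ fun α : Fin k → ℕ => ((memLp_gaussConjFun j α).toLp _ : SquareIntegrable k) :=
  orthonormal_prod (continuous_gaussConjFactor j) (integrable_conj_gaussConjFactor_mul j)
    (integral_conj_gaussConjFactor_mul j)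

end GaussVectors

section Multiplication

variable {k : ℕ} {b c : Bool}

/-- The isometric embedding of the Fock space into square-integrable functions. -/
noncomputable def fockEmbed (k : ℕ) (b : Bool) : FockSpace k b →ₗᵢ[ℂ] SquareIntegrable k :=
  (orthonormal_gaussFun.comp (Subtype.val : ParityIndex k b → Fin k → ℕ)
    Subtype.val_injective).lpIsometry

/-- The isometric embedding onto the orthogonal parts of the products with `conj z_j`. -/
noncomputable def fockConjEmbed (b : Bool) (j : Fin k) :
    FockSpace k b →ₗᵢ[ℂ] SquareIntegrable k :=
  ((orthonormal_gaussConjFun j).comp (Subtype.val : ParityIndex k b → Fin k → ℕ)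
    Subtype.val_injective).lpIsometry

theorem fockEmbed_single [DecidableEq (ParityIndex k b)] (α : ParityIndex k b) (a : ℂ) :
    fockEmbed k b (lp.single 2 α a) = a • ((memLp_gaussFun α.1).toLp _ : SquareIntegrable k) :=
  Orthonormal.lpIsometry_single (I := ParityIndex k b) _ α a

theorem fockConjEmbed_single [DecidableEq (ParityIndex k b)] (j : Fin k) (α : ParityIndex k b)
    (a : ℂ) : fockConjEmbed b j (lp.single 2 α a) =
      a • ((memLp_gaussConjFun j α.1).toLp _ : SquareIntegrable k) :=
  Orthonormal.lpIsometry_single (I := ParityIndex k b) _ α a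

/-- The weight of the difference between two normalizations of the lowering operator. -/
noncomputable def remainderWeight (j : Fin k) (α : ParityIndex k b) : ℝ :=
  √(α.1 j + 1) * (√(α.degree + 2) * (√(α.degree + 1))⁻¹ - 1)

theorem abs_remainderWeight_le (j : Fin k) (α : ParityIndex k b) : |remainderWeight j α| ≤ 1 := by
  have h1 : √((α.degree : ℝ) + 1) ≤ √((α.degree : ℝ) + 2) := Real.sqrt_le_sqrt (by linarith)
  have h2 : 0 < √((α.degree : ℝ) + 1) := by positivity
  have h3 : √((α.1 j : ℝ) + 1) ≤ √((α.degree : ℝ) + 1) := by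
    refine Real.sqrt_le_sqrt ?_
    have : (α.1 j : ℝ) ≤ α.degree := by exact_mod_cast apply_le_degree α j
    linarith
  have h4 : 0 ≤ √((α.degree : ℝ) + 2) * (√((α.degree : ℝ) + 1))⁻¹ - 1 := by
    rw [sub_nonneg, ← div_eq_mul_inv, one_le_div h2]
    exact h1
  rw [remainderWeight, abs_of_nonneg (mul_nonneg (Real.sqrt_nonneg _) h4)]
  refine (mul_le_mul_of_nonneg_right h3 h4).trans ?_
  have h5 : √((α.degree : ℝ) + 1) * (√((α.degree : ℝ) + 2) * (√((α.degree : ℝ) + 1))⁻¹ - 1) =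
      √((α.degree : ℝ) + 2) - √((α.degree : ℝ) + 1) := by
    field_simp
  rw [h5, sub_le_iff_le_add, Real.sqrt_le_left (by positivity)]
  have := Real.sq_sqrt (x := (α.degree : ℝ) + 1) (by positivity)
  nlinarith

/-- The bounded correction between `conj z_j` and the lowering operator. -/
noncomputable def conjCorrection (h : b ≠ c) (j : Fin k) :
    FockSpace k b →L[ℂ] SquareIntegrable k :=
  (fockConjEmbed b j).toContinuousLinearMap -
    (fockEmbed k c).toContinuousLinearMap ∘L
      lpPull (raise h.symm j) (raise_injective h.symm j) (remainderWeight j)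
        (abs_remainderWeight_le j)

/-- Damping followed by multiplication by `z_j`. -/
noncomputable def mulOp (h : b ≠ c) (j : Fin k) : FockSpace k b →L[ℂ] SquareIntegrable k :=
  (fockEmbed k c).toContinuousLinearMap ∘L raiseOp h j

/-- Damping followed by multiplication by `conj z_j`. -/
noncomputable def conjMulOp (h : b ≠ c) (j : Fin k) : FockSpace k b →L[ℂ] SquareIntegrable k :=
  (fockEmbed k c).toContinuousLinearMap ∘L lowerOp h.symm j + conjCorrection h j ∘L dampOp k b

/-- The vectors on which `mulOp` and `conjMulOp` are genuine multiplications of one function. -/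
def IsMultiplied (h : b ≠ c) (u : FockSpace k b) : Prop :=
  ∃ p : (Fin k → ℂ) → ℂ, ∀ j, mulOp h j u =ᵐ[volume] (fun z => z j * p z) ∧
    conjMulOp h j u =ᵐ[volume] fun z => starRingEnd ℂ (z j) * p z

theorem mulOp_single [DecidableEq (ParityIndex k b)] (h : b ≠ c) (j : Fin k)
    (α : ParityIndex k b) (a : ℂ) :
    mulOp h j (lp.single 2 α a) = (shiftWeight j α * a) •
      ((memLp_gaussFun (α.1 + Pi.single j 1)).toLp _ : SquareIntegrable k) := by
  classical
  simp only [mulOp, raiseOp, lowerOp, ContinuousLinearMap.comp_apply, lpPull_adjoint_single]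
  exact fockEmbed_single _ _

theorem dampOp_single [DecidableEq (ParityIndex k b)] (α : ParityIndex k b) (a : ℂ) :
    dampOp k b (lp.single 2 α a) = lp.single 2 α (((√(α.degree + 1))⁻¹ : ℝ) * a) :=
  lpPull_single id _ _ _ α a

theorem conjMulOp_single_raise [DecidableEq (ParityIndex k b)] (h : b ≠ c) (j : Fin k)
    (α : ParityIndex k c) (a : ℂ) :
    conjMulOp h j (lp.single 2 (raise h.symm j α) a) =
      (((√(α.degree + 2))⁻¹ : ℝ) * a) • (((memLp_gaussConjFun j (α.1 + Pi.single j 1)).toLp _ +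
      ((√(α.1 j + 1) : ℝ) : ℂ) • (memLp_gaussFun α.1).toLp _ : SquareIntegrable k)) := by
  classical
  have h1 : conjMulOp h j (lp.single 2 (raise h.symm j α) a) =
      (shiftWeight j α * a) • ((memLp_gaussFun α.1).toLp _ : SquareIntegrable k) +
      ((((√((raise h.symm j α).degree + 1))⁻¹ : ℝ) * a) •
        ((memLp_gaussConjFun j (α.1 + Pi.single j 1)).toLp _ : SquareIntegrable k) -
      (remainderWeight j α * (((√((raise h.symm j α).degree + 1))⁻¹ : ℝ) * a)) •
        ((memLp_gaussFun α.1).toLp _ : SquareIntegrable k)) := by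
    simp only [conjMulOp, conjCorrection, lowerOp, ContinuousLinearMap.comp_apply,
      add_apply, sub_apply, dampOp_single, lpPull_single]
    congr 1
    · exact fockEmbed_single _ _
    · congr 1
      · exact fockConjEmbed_single _ _ _
      · exact fockEmbed_single _ _
  have h2 : (((raise h.symm j α).degree : ℝ) + 1) = α.degree + 2 := by
    rw [degree_raise]
    push_cast
    ring
  have h3 : shiftWeight j α - remainderWeight j α * (√((α.degree : ℝ) + 2))⁻¹ =
      (√((α.degree : ℝ) + 2))⁻¹ * √(α.1 j + 1) := by
    rw [shiftWeight, remainderWeight, Real.sqrt_div (by positivity)]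
    have h4 : √((α.degree : ℝ) + 1) ≠ 0 := by positivity
    have h5 : √((α.degree : ℝ) + 2) ≠ 0 := by positivity
    field_simp
    ring
  have h6 := congrArg (fun t : ℝ => (t : ℂ)) h3
  simp only [Complex.ofReal_sub, Complex.ofReal_mul] at h6
  rw [h1, h2, smul_add, smul_smul]
  rw [show ((√((α.degree : ℝ) + 2))⁻¹ : ℝ) * a * ((√(α.1 j + 1) : ℝ) : ℂ) =
    shiftWeight j α * a - remainderWeight j α * (((√((α.degree : ℝ) + 2))⁻¹ : ℝ) * a) by
    linear_combination -a * h6]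
  rw [sub_smul]
  abel

theorem conjMulOp_single_of_eq_zero [DecidableEq (ParityIndex k b)] (h : b ≠ c) (j : Fin k)
    (β : ParityIndex k b) (hβ : β.1 j = 0) (a : ℂ) :
    conjMulOp h j (lp.single 2 β a) =
      (((√(β.degree + 1))⁻¹ : ℝ) * a) •
        ((memLp_gaussConjFun j β.1).toLp _ : SquareIntegrable k) := by
  have hne : ∀ α : ParityIndex k c, raise h.symm j α ≠ β := by
    rintro α rfl
    exact (raise_apply_pos h.symm j α).ne' hβ
  simp only [conjMulOp, conjCorrection, lowerOp, ContinuousLinearMap.comp_apply,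
      add_apply, sub_apply, dampOp_single,
      lpPull_single_of_ne _ _ _ _ _ hne, map_zero, zero_add, sub_zero]
  exact fockConjEmbed_single _ _ _

theorem isMultiplied_single [DecidableEq (ParityIndex k b)] (h : b ≠ c) (β : ParityIndex k b)
    (a : ℂ) : IsMultiplied h (lp.single 2 β a : FockSpace k b) := by
  refine ⟨fun z => (((√(β.degree + 1))⁻¹ : ℝ) * a) * gaussFun β.1 z, fun j => ⟨?_, ?_⟩⟩
  · rw [mulOp_single]
    filter_upwards [Lp.coeFn_smul (shiftWeight j β * a)
      ((memLp_gaussFun (β.1 + Pi.single j 1)).toLp _ : SquareIntegrable k),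
      (memLp_gaussFun (β.1 + Pi.single j 1)).coeFn_toLp] with z hz1 hz2
    rw [hz1, Pi.smul_apply, hz2, mul_left_comm, self_mul_gaussFun, shiftWeight,
      Real.sqrt_div (by positivity), div_eq_mul_inv, smul_eq_mul]
    push_cast
    ring
  · by_cases hβ : β.1 j = 0
    · rw [conjMulOp_single_of_eq_zero h j β hβ]
      filter_upwards [Lp.coeFn_smul (((√((β.degree : ℝ) + 1))⁻¹ : ℝ) * a)
        ((memLp_gaussConjFun j β.1).toLp _ : SquareIntegrable k),
        (memLp_gaussConjFun j β.1).coeFn_toLp] with z hz1 hz2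
      rw [hz1, Pi.smul_apply, hz2, mul_left_comm, conj_mul_gaussFun_of_eq_zero j _ hβ,
        smul_eq_mul]
    · obtain ⟨α, rfl⟩ := exists_raise_eq h.symm j β (Nat.pos_of_ne_zero hβ)
      have h2 : (((raise h.symm j α).degree : ℝ) + 1) = α.degree + 2 := by
        rw [degree_raise]
        push_cast
        ring
      rw [conjMulOp_single_raise, h2]
      filter_upwards [Lp.coeFn_smul (((√((α.degree : ℝ) + 2))⁻¹ : ℝ) * a)
        ((memLp_gaussConjFun j (α.1 + Pi.single j 1)).toLp _ +
          ((√(α.1 j + 1) : ℝ) : ℂ) • (memLp_gaussFun α.1).toLp _ : SquareIntegrable k),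
        Lp.coeFn_add ((memLp_gaussConjFun j (α.1 + Pi.single j 1)).toLp _ : SquareIntegrable k)
          (((√(α.1 j + 1) : ℝ) : ℂ) • (memLp_gaussFun α.1).toLp _ : SquareIntegrable k),
        Lp.coeFn_smul ((√(α.1 j + 1) : ℝ) : ℂ)
          ((memLp_gaussFun α.1).toLp _ : SquareIntegrable k),
        (memLp_gaussFun α.1).coeFn_toLp,
        (memLp_gaussConjFun j (α.1 + Pi.single j 1)).coeFn_toLp] with z hz1 hz2 hz3 hz4 hz5
      rw [hz1, Pi.smul_apply, hz2, Pi.add_apply, hz3, Pi.smul_apply, hz4, hz5, mul_left_comm]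
      change _ = _ * (starRingEnd ℂ (z j) * gaussFun (α.1 + Pi.single j 1) z)
      rw [conj_mul_gaussFun_raise, smul_eq_mul, smul_eq_mul]

theorem isMultiplied_zero (h : b ≠ c) : IsMultiplied h (0 : FockSpace k b) := by
  refine ⟨0, fun j => ⟨?_, ?_⟩⟩ <;>
  · rw [map_zero]
    filter_upwards [Lp.coeFn_zero ℂ 2 (volume : Measure (Fin k → ℂ))] with z hz
    rw [hz, Pi.zero_apply, mul_zero]

theorem IsMultiplied.add {h : b ≠ c} {u v : FockSpace k b} (hu : IsMultiplied h u)
    (hv : IsMultiplied h v) : IsMultiplied h (u + v) := by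
  obtain ⟨p, hp⟩ := hu
  obtain ⟨q, hq⟩ := hv
  refine ⟨p + q, fun j => ⟨?_, ?_⟩⟩
  · rw [map_add]
    filter_upwards [Lp.coeFn_add (mulOp h j u) (mulOp h j v), (hp j).1, (hq j).1]
      with z hz1 hz2 hz3
    rw [hz1, Pi.add_apply, hz2, hz3, Pi.add_apply, mul_add]
  · rw [map_add]
    filter_upwards [Lp.coeFn_add (conjMulOp h j u) (conjMulOp h j v), (hp j).2, (hq j).2]
      with z hz1 hz2 hz3
    rw [hz1, Pi.add_apply, hz2, hz3, Pi.add_apply, mul_add]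

theorem isMultiplied_sum_single [DecidableEq (ParityIndex k b)] (h : b ≠ c)
    (s : Finset (ParityIndex k b)) (u : FockSpace k b) :
    IsMultiplied h (∑ α ∈ s, (lp.single 2 α (u α) : FockSpace k b)) :=
  Finset.sum_induction _ (IsMultiplied h) (fun _ _ => IsMultiplied.add) (isMultiplied_zero h)
    fun α _ => isMultiplied_single h α (u α)

end Multiplication

theorem ae_coeFn_sum {k : ℕ} {κ : Type*} (s : Finset κ) (F : κ → SquareIntegrable k) :
    ∀ᵐ z, (∑ i ∈ s, F i : SquareIntegrable k) z = ∑ i ∈ s, F i z := by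
  classical
  induction s using Finset.induction_on with
  | empty =>
    simp only [Finset.sum_empty]
    exact Lp.coeFn_zero ℂ 2 volume
  | insert i s hi ih =>
    rw [Finset.sum_insert hi]
    filter_upwards [Lp.coeFn_add (F i) (∑ i ∈ s, F i), ih] with z h1 h2
    rw [h1, Pi.add_apply, h2, Finset.sum_insert hi]

theorem sum_sq_norm_le {κ : Type*} [Fintype κ] (y : κ → ℂ) :
    ∑ j, ‖y j‖ ^ 2 ≤ (Fintype.card κ + 1 : ℝ) * ‖y‖ ^ 2 := by
  calc ∑ j, ‖y j‖ ^ 2 ≤ ∑ _j : κ, ‖y‖ ^ 2 := Finset.sum_le_sum fun j _ => by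
        gcongr
        exact norm_le_pi_norm y j
    _ = Fintype.card κ * ‖y‖ ^ 2 := by simp
    _ ≤ _ := by nlinarith [sq_nonneg ‖y‖]

theorem integral_sq_norm_eq {k : ℕ} (F : SquareIntegrable k) : ∫ z, ‖F z‖ ^ 2 = ‖F‖ ^ 2 := by
  have h1 : (inner ℂ F F : ℂ) = ((‖F‖ ^ 2 : ℝ) : ℂ) := by
    rw [inner_self_eq_norm_sq_to_K]
    norm_cast
  have h2 : (inner ℂ F F : ℂ) = ((∫ z, ‖F z‖ ^ 2 : ℝ) : ℂ) := by
    rw [L2.inner_def, ← integral_complex_ofReal]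
    refine integral_congr_ae (Eventually.of_forall fun z => ?_)
    simp only [inner_self_eq_norm_sq_to_K]
    norm_cast
  exact_mod_cast h2.symm.trans h1

theorem integrable_sq_norm {k : ℕ} (F : SquareIntegrable k) : Integrable fun z => ‖F z‖ ^ 2 :=
  (memLp_two_iff_integrable_sq_norm (Lp.memLp F).1).mp (Lp.memLp F)

namespace RealSymbol

variable {k : ℕ} {ι : Type*} {b c : Bool}

theorem eval_smul (f : RealSymbol k ι) (t : ℝ) (v : Fin k → ℂ) :
    f.eval ((t : ℂ) • v) = (t : ℂ) • f.eval v := by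
  simp only [eval, Pi.smul_apply, smul_eq_mul, map_mul, Complex.conj_ofReal, mul_smul,
    Finset.smul_sum, smul_add]

theorem continuous_eval (f : RealSymbol k ι) : Continuous f.eval := by
  unfold eval
  fun_prop

variable [Fintype ι]

theorem IsElliptic.exists_pos_le {f : RealSymbol k ι} (hf : f.IsElliptic) :
    ∃ c : ℝ, 0 < c ∧ ∀ (v : Fin k → ℂ) (x : ι → ℂ),
      c * ((∑ j, ‖v j‖ ^ 2) * ∑ i, ‖x i‖ ^ 2) ≤ ∑ i, ‖(f.eval v).mulVec x i‖ ^ 2 := by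
  set Q : (Fin k → ℂ) × (ι → ℂ) → ℝ := fun p => ∑ i, ‖(f.eval p.1).mulVec p.2 i‖ ^ 2 with hQ
  have hcont : Continuous Q := by
    have h1 : Continuous fun p : (Fin k → ℂ) × (ι → ℂ) => (f.eval p.1).mulVec p.2 :=
      (f.continuous_eval.comp continuous_fst).matrix_mulVec continuous_snd
    exact continuous_finsetSum _ fun i _ => (((continuous_apply i).comp h1).norm.pow 2)
  have hpos : ∀ p ∈ Metric.sphere (0 : Fin k → ℂ) 1 ×ˢ Metric.sphere (0 : ι → ℂ) 1, 0 < Q p := by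
    rintro ⟨v, x⟩ ⟨hv, hx⟩
    have hv0 : v ≠ 0 := by
      rintro rfl
      simp at hv
    have hx0 : x ≠ 0 := by
      rintro rfl
      simp at hx
    have h1 : (f.eval v).mulVec x ≠ 0 := fun h => hx0 (hf v hv0 x h)
    obtain ⟨i, hi⟩ := Function.ne_iff.mp h1
    refine Finset.sum_pos' (fun i _ => by positivity) ⟨i, Finset.mem_univ i, ?_⟩
    have := norm_pos_iff.mpr hi
    positivity
  have hcompact : IsCompact (Metric.sphere (0 : Fin k → ℂ) 1 ×ˢ Metric.sphere (0 : ι → ℂ) 1) :=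
    (isCompact_sphere _ _).prod (isCompact_sphere _ _)
  obtain ⟨c, hc, hcQ⟩ : ∃ c : ℝ, 0 < c ∧
      ∀ p ∈ Metric.sphere (0 : Fin k → ℂ) 1 ×ˢ Metric.sphere (0 : ι → ℂ) 1, c ≤ Q p := by
    rcases (Metric.sphere (0 : Fin k → ℂ) 1 ×ˢ Metric.sphere (0 : ι → ℂ) 1).eq_empty_or_nonempty
      with he | hne
    · exact ⟨1, one_pos, by simp [he]⟩
    · obtain ⟨p, hp, hmin⟩ := hcompact.exists_isMinOn hne hcont.continuousOn
      exact ⟨Q p, hpos p hp, fun q hq => hmin hq⟩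
  have hscale : ∀ v x, c * (‖v‖ ^ 2 * ‖x‖ ^ 2) ≤ Q (v, x) := by
    intro v x
    have hQ0 : 0 ≤ Q (v, x) := Finset.sum_nonneg fun i _ => by positivity
    by_cases hv : v = 0
    · simpa [hv] using hQ0
    by_cases hx : x = 0
    · simpa [hx] using hQ0
    have h1 := hcQ (((‖v‖⁻¹ : ℝ) : ℂ) • v, ((‖x‖⁻¹ : ℝ) : ℂ) • x)
      ⟨by simp [norm_smul, hv], by simp [norm_smul, hx]⟩
    have h2 : Q (((‖v‖⁻¹ : ℝ) : ℂ) • v, ((‖x‖⁻¹ : ℝ) : ℂ) • x) =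
        (‖v‖⁻¹ ^ 2 * ‖x‖⁻¹ ^ 2) * Q (v, x) := by
      simp only [hQ, eval_smul, Matrix.smul_mulVec, Matrix.mulVec_smul, Pi.smul_apply, norm_smul,
        Complex.norm_real, Real.norm_eq_abs, mul_pow, sq_abs, Finset.mul_sum]
      exact Finset.sum_congr rfl fun i _ => by ring
    rw [h2] at h1
    have hv' := norm_pos_iff.mpr hv
    have hx' := norm_pos_iff.mpr hx
    have h3 : (‖v‖ ^ 2 * ‖x‖ ^ 2) * (‖v‖⁻¹ ^ 2 * ‖x‖⁻¹ ^ 2) = 1 := by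
      field_simp
    calc c * (‖v‖ ^ 2 * ‖x‖ ^ 2) ≤
        ((‖v‖⁻¹ ^ 2 * ‖x‖⁻¹ ^ 2) * Q (v, x)) * (‖v‖ ^ 2 * ‖x‖ ^ 2) :=
          mul_le_mul_of_nonneg_right h1 (by positivity)
      _ = Q (v, x) * ((‖v‖ ^ 2 * ‖x‖ ^ 2) * (‖v‖⁻¹ ^ 2 * ‖x‖⁻¹ ^ 2)) := by ring
      _ = Q (v, x) := by rw [h3, mul_one]
  refine ⟨c / ((Fintype.card (Fin k) + 1) * (Fintype.card ι + 1)), by positivity, fun v x => ?_⟩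
  refine le_trans ?_ (hscale v x)
  rw [div_mul_eq_mul_div, div_le_iff₀ (by positivity)]
  calc c * ((∑ j, ‖v j‖ ^ 2) * ∑ i, ‖x i‖ ^ 2) ≤
      c * (((Fintype.card (Fin k) + 1 : ℝ) * ‖v‖ ^ 2) * ((Fintype.card ι + 1 : ℝ) * ‖x‖ ^ 2)) := by
        gcongr
        exacts [sum_sq_norm_le v, sum_sq_norm_le x]
    _ = _ := by ring

/-- The operator of multiplication by a symbol, preceded by damping. -/
noncomputable def mulSymbol (h : b ≠ c) (f : RealSymbol k ι) :
    FockPow k b ι →L[ℂ] PiLp 2 (fun _ : ι => SquareIntegrable k) :=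
  ∑ j, (matOp (f.1 j) (mulOp h j) + matOp (f.2 j) (conjMulOp h j))

theorem mulSymbol_apply (h : b ≠ c) (f : RealSymbol k ι) (u : FockPow k b ι) (i : ι) :
    f.mulSymbol h u i = ∑ j, ((∑ i', f.1 j i i' • mulOp h j (u i')) +
      ∑ i', f.2 j i i' • conjMulOp h j (u i')) := by
  simp [mulSymbol]

theorem ae_mulSymbol_apply (h : b ≠ c) (f : RealSymbol k ι) (u : FockPow k b ι)
    (p : ι → (Fin k → ℂ) → ℂ)
    (hp : ∀ i j, mulOp h j (u i) =ᵐ[volume] (fun z => z j * p i z) ∧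
      conjMulOp h j (u i) =ᵐ[volume] fun z => starRingEnd ℂ (z j) * p i z) (i : ι) :
    ∀ᵐ z, f.mulSymbol h u i z = (f.eval z).mulVec (fun i' => p i' z) i := by
  have h1 : ∀ j, ∀ᵐ z, ∀ i', mulOp h j (u i') z = z j * p i' z := fun j =>
    ae_all_iff.mpr fun i' => (hp i' j).1
  have h2 : ∀ j, ∀ᵐ z, ∀ i', conjMulOp h j (u i') z = starRingEnd ℂ (z j) * p i' z := fun j =>
    ae_all_iff.mpr fun i' => (hp i' j).2
  have h3 := ae_all_iff.mpr h1
  have h4 := ae_all_iff.mpr h2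
  have hsm : ∀ j, ∀ᵐ z, ∀ i', (f.1 j i i' • mulOp h j (u i') : SquareIntegrable k) z =
      f.1 j i i' * mulOp h j (u i') z := fun j => ae_all_iff.mpr fun i' => Lp.coeFn_smul _ _
  have hsm' : ∀ j, ∀ᵐ z, ∀ i', (f.2 j i i' • conjMulOp h j (u i') : SquareIntegrable k) z =
      f.2 j i i' * conjMulOp h j (u i') z := fun j => ae_all_iff.mpr fun i' => Lp.coeFn_smul _ _
  have hadd : ∀ j, ∀ᵐ z, ((∑ i', f.1 j i i' • mulOp h j (u i')) +
      ∑ i', f.2 j i i' • conjMulOp h j (u i') : SquareIntegrable k) z =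
      (∑ i', f.1 j i i' • mulOp h j (u i') : SquareIntegrable k) z +
      (∑ i', f.2 j i i' • conjMulOp h j (u i') : SquareIntegrable k) z :=
    fun j => Lp.coeFn_add _ _
  have hs : ∀ j, ∀ᵐ z, (∑ i', f.1 j i i' • mulOp h j (u i') : SquareIntegrable k) z =
      ∑ i', (f.1 j i i' • mulOp h j (u i') : SquareIntegrable k) z := fun j =>
    ae_coeFn_sum _ _
  have hs' : ∀ j, ∀ᵐ z, (∑ i', f.2 j i i' • conjMulOp h j (u i') : SquareIntegrable k) z =
      ∑ i', (f.2 j i i' • conjMulOp h j (u i') : SquareIntegrable k) z := fun j =>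
    ae_coeFn_sum _ _
  rw [mulSymbol_apply]
  filter_upwards [h3, h4, ae_all_iff.mpr hsm, ae_all_iff.mpr hsm', ae_all_iff.mpr hadd,
    ae_all_iff.mpr hs, ae_all_iff.mpr hs', ae_coeFn_sum Finset.univ fun j =>
    ((∑ i', f.1 j i i' • mulOp h j (u i')) +
      ∑ i', f.2 j i i' • conjMulOp h j (u i') : SquareIntegrable k)]
    with z h3 h4 hsm hsm' hadd hs hs' hz
  rw [hz]
  simp only [hadd, hs, hs', hsm, hsm', h3, h4, eval, Matrix.mulVec, dotProduct,
    Matrix.sum_apply, Matrix.add_apply, Matrix.smul_apply, smul_eq_mul, Finset.sum_mul]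
  rw [Finset.sum_comm]
  refine Finset.sum_congr rfl fun j _ => ?_
  rw [← Finset.sum_add_distrib]
  exact Finset.sum_congr rfl fun i' _ => by ring

end RealSymbol

theorem matOp_comp_left {ι : Type*} [Fintype ι] [DecidableEq ι] {H H' H'' : Type*}
    [NormedAddCommGroup H] [InnerProductSpace ℂ H] [NormedAddCommGroup H'] [InnerProductSpace ℂ H']
    [NormedAddCommGroup H''] [InnerProductSpace ℂ H''] (A : Matrix ι ι ℂ) (S : H' →L[ℂ] H'')
    (T : H →L[ℂ] H') : matOp A (S ∘L T) = matOp 1 S ∘L matOp A T := by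
  ext u i
  simp [Matrix.one_apply]

theorem matOp_comp_right {ι : Type*} [Fintype ι] [DecidableEq ι] {H H' H'' : Type*}
    [NormedAddCommGroup H] [InnerProductSpace ℂ H] [NormedAddCommGroup H'] [InnerProductSpace ℂ H']
    [NormedAddCommGroup H''] [InnerProductSpace ℂ H''] (A : Matrix ι ι ℂ) (S : H' →L[ℂ] H'')
    (T : H →L[ℂ] H') : matOp A (S ∘L T) = matOp A S ∘L matOp 1 T := by
  ext u i
  simp [Matrix.one_apply]

theorem matOp_add_right {ι : Type*} [Fintype ι] {H H' : Type*}
    [NormedAddCommGroup H] [InnerProductSpace ℂ H] [NormedAddCommGroup H'] [InnerProductSpace ℂ H']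
    (A : Matrix ι ι ℂ) (S T : H →L[ℂ] H') : matOp A (S + T) = matOp A S + matOp A T := by
  ext u i
  simp [Finset.sum_add_distrib]

theorem sq_norm_dampOp_le {k : ℕ} {b : Bool} (d : ℕ) (s : Finset (ParityIndex k b))
    (hs : ∀ α : ParityIndex k b, α.degree < d → α ∈ s) (u : FockSpace k b) :
    ‖dampOp k b u‖ ^ 2 ≤ ∑ α ∈ s, ‖u α‖ ^ 2 + ‖u‖ ^ 2 / (d + 1) := by
  classical
  have h5 : ∀ v : FockSpace k b, HasSum (fun α => ‖v α‖ ^ 2) (‖v‖ ^ 2) := fun v => by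
    simpa using lp.hasSum_norm (p := 2) (by simp) v
  have h6 : HasSum (fun α => if α ∈ s then ‖u α‖ ^ 2 else 0) (∑ α ∈ s, ‖u α‖ ^ 2) := by
    have := hasSum_sum_of_ne_finset_zero (L := .unconditional _) (f := fun α => if α ∈ s then ‖u α‖ ^ 2 else 0) (s := s)
      (fun α hα => if_neg hα)
    rwa [Finset.sum_congr rfl fun α hα => if_pos hα] at this
  refine hasSum_le (fun α => ?_) (h5 _) (h6.add ((h5 u).div_const _))
  rw [dampOp_apply, norm_mul, Complex.norm_real, mul_pow, Real.norm_eq_abs, sq_abs, inv_pow,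
    Real.sq_sqrt (by positivity)]
  have hu : 0 ≤ ‖u α‖ ^ 2 := by positivity
  split_ifs with hα
  · have h1 : ((α.degree : ℝ) + 1)⁻¹ ≤ 1 := inv_le_one_of_one_le₀ (by simp)
    have h2 : 0 ≤ ‖u α‖ ^ 2 / ((d : ℝ) + 1) := by positivity
    nlinarith
  · have h1 : d ≤ α.degree := by
      by_contra h
      exact hα (hs α (by omega))
    have h2 : (d : ℝ) ≤ α.degree := by exact_mod_cast h1
    rw [zero_add, div_eq_inv_mul]
    gcongr

namespace RealSymbol

variable {k : ℕ} {ι : Type*} [Fintype ι] {b c : Bool}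

theorem mulSymbol_estimate_of_isMultiplied (h : b ≠ c) {f : RealSymbol k ι} {r : ℝ}
    (hr : ∀ (v : Fin k → ℂ) (x : ι → ℂ),
      r * ((∑ j, ‖v j‖ ^ 2) * ∑ i, ‖x i‖ ^ 2) ≤ ∑ i, ‖(f.eval v).mulVec x i‖ ^ 2)
    (u : FockPow k b ι) (hu : ∀ i, IsMultiplied h (u i)) :
    r * ∑ i, ∑ j, ‖mulOp h j (u i)‖ ^ 2 ≤ ‖f.mulSymbol h u‖ ^ 2 := by
  choose p hp using hu
  have h1 : ‖f.mulSymbol h u‖ ^ 2 = ∫ z, ∑ i, ‖f.mulSymbol h u i z‖ ^ 2 := by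
    rw [PiLp.norm_sq_eq_of_L2, integral_finsetSum _ fun i _ => integrable_sq_norm _]
    simp_rw [integral_sq_norm_eq]
  have h2 : r * ∑ i, ∑ j, ‖mulOp h j (u i)‖ ^ 2 =
      ∫ z, r * ∑ i, ∑ j, ‖mulOp h j (u i) z‖ ^ 2 := by
    rw [integral_const_mul, integral_finsetSum _ fun i _ =>
      integrable_finsetSum _ fun j _ => integrable_sq_norm _]
    congr 1
    refine Finset.sum_congr rfl fun i _ => ?_
    rw [integral_finsetSum _ fun j _ => integrable_sq_norm _]
    simp_rw [integral_sq_norm_eq]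
  rw [h1, h2]
  refine integral_mono_ae ?_ ?_ ?_
  · exact (integrable_finsetSum _ fun i _ =>
      integrable_finsetSum _ fun j _ => integrable_sq_norm _).const_mul _
  · exact integrable_finsetSum _ fun i _ => integrable_sq_norm _
  · have h3 := ae_all_iff.mpr fun i => f.ae_mulSymbol_apply h u p hp i
    have h4 := ae_all_iff.mpr fun i => ae_all_iff.mpr fun j => (hp i j).1
    filter_upwards [h3, h4] with z hz1 hz2
    simp only [hz1, hz2]
    refine le_of_eq_of_le ?_ (hr z fun i => p i z)
    simp_rw [norm_mul, mul_pow, ← Finset.sum_mul, ← Finset.mul_sum]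

theorem mulSymbol_estimate (h : b ≠ c) {f : RealSymbol k ι} {r : ℝ}
    (hr : ∀ (v : Fin k → ℂ) (x : ι → ℂ),
      r * ((∑ j, ‖v j‖ ^ 2) * ∑ i, ‖x i‖ ^ 2) ≤ ∑ i, ‖(f.eval v).mulVec x i‖ ^ 2)
    (u : FockPow k b ι) :
    r * ∑ i, ∑ j, ‖mulOp h j (u i)‖ ^ 2 ≤ ‖f.mulSymbol h u‖ ^ 2 := by
  classical
  set t : Finset (ParityIndex k b) → FockPow k b ι := fun s =>
    WithLp.toLp 2 fun i => ∑ α ∈ s, (lp.single 2 α (u i α) : FockSpace k b) with ht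
  have hlim : Tendsto t atTop (𝓝 u) := by
    have h1 : Tendsto (fun s => (fun i => ∑ α ∈ s, (lp.single 2 α (u i α) : FockSpace k b)))
        atTop (𝓝 (WithLp.ofLp u)) :=
      tendsto_pi_nhds.mpr fun i => lp.hasSum_single (by simp) (u i)
    exact ((PiLp.continuous_toLp 2 _).tendsto _).comp h1
  have hl : Continuous fun u : FockPow k b ι => r * ∑ i, ∑ j, ‖mulOp h j (u i)‖ ^ 2 := by
    fun_prop
  have hr' : Continuous fun u : FockPow k b ι => ‖f.mulSymbol h u‖ ^ 2 := by fun_prop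
  refine le_of_tendsto_of_tendsto' ((hl.tendsto u).comp hlim) ((hr'.tendsto u).comp hlim) ?_
  intro s
  exact mulSymbol_estimate_of_isMultiplied h hr (t s) fun i => isMultiplied_sum_single h s (u i)

theorem mulSymbol_eq [DecidableEq ι] (h : b ≠ c) (f : RealSymbol k ι) :
    f.mulSymbol h = matOp 1 (fockEmbed k c).toContinuousLinearMap ∘L f.toOp h +
      (∑ j, matOp (f.2 j) (conjCorrection h j)) ∘L matOp 1 (dampOp k b) := by
  simp only [mulSymbol, toOp, mulOp, conjMulOp, matOp_add_right,
    matOp_comp_left _ (fockEmbed k c).toContinuousLinearMap, matOp_comp_right _ _ (dampOp k b)]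
  ext1 u
  simp only [sum_apply, add_apply, ContinuousLinearMap.comp_apply, map_sum, map_add,
    ← Finset.sum_add_distrib, add_assoc]

/-- The Gårding-type estimate for elliptic symbols. -/
theorem IsElliptic.exists_estimate_dampOp [DecidableEq ι] (hk : 1 ≤ k) (h : b ≠ c)
    {f : RealSymbol k ι} (hf : f.IsElliptic) : ∃ C : ℝ, 0 < C ∧ ∀ u : FockPow k b ι,
      ‖u‖ ≤ C * (‖f.toOp h u‖ + ‖matOp 1 (dampOp k b) u‖) := by
  obtain ⟨r, hr, hrf⟩ := hf.exists_pos_le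
  set P : FockPow k c ι →L[ℂ] PiLp 2 (fun _ : ι => SquareIntegrable k) :=
    matOp 1 (fockEmbed k c).toContinuousLinearMap
  set Q : FockPow k b ι →L[ℂ] PiLp 2 (fun _ : ι => SquareIntegrable k) :=
    ∑ j, matOp (f.2 j) (conjCorrection h j)
  have h1 : ∀ u : FockPow k b ι, √r * ‖u‖ ≤ ‖f.mulSymbol h u‖ := by
    intro u
    refine le_of_sq_le_sq ?_ (norm_nonneg _)
    rw [mul_pow, Real.sq_sqrt hr.le]
    refine le_trans ?_ (mulSymbol_estimate h hrf u)
    rw [PiLp.norm_sq_eq_of_L2]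
    gcongr with i
    refine (sq_norm_le_sum_raiseOp hk h (u i)).trans (le_of_eq ?_)
    refine Finset.sum_congr rfl fun j _ => ?_
    rw [mulOp, ContinuousLinearMap.comp_apply, LinearIsometry.coe_toContinuousLinearMap,
      LinearIsometry.norm_map]
  have hr' : 0 < √r := Real.sqrt_pos.mpr hr
  refine ⟨(‖P‖ + ‖Q‖ + 1) / √r, by positivity, fun u => ?_⟩
  rw [div_mul_eq_mul_div, le_div_iff₀ hr', mul_comm]
  refine (h1 u).trans ?_
  rw [mulSymbol_eq]
  refine (norm_add_le _ _).trans ?_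
  have h2 : ‖P (f.toOp h u)‖ ≤ ‖P‖ * ‖f.toOp h u‖ := P.le_opNorm _
  have h3 : ‖Q (matOp 1 (dampOp k b) u)‖ ≤ ‖Q‖ * ‖matOp 1 (dampOp k b) u‖ := Q.le_opNorm _
  refine (add_le_add h2 h3).trans ?_
  have := norm_nonneg P
  have := norm_nonneg Q
  have := norm_nonneg (f.toOp h u)
  have := norm_nonneg (matOp 1 (dampOp k b) u)
  nlinarith [mul_nonneg (norm_nonneg P) (norm_nonneg (matOp 1 (dampOp k b) u)),
    mul_nonneg (norm_nonneg Q) (norm_nonneg (f.toOp h u))]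

/-- Finitely many coordinates of a family of vectors of the Fock space. -/
noncomputable def coords (ι : Type*) [Fintype ι] (s : Finset (ParityIndex k b)) :
    FockPow k b ι →L[ℂ] (ι → s → ℂ) :=
  ContinuousLinearMap.pi fun i => ContinuousLinearMap.pi fun α =>
    lp.evalCLM ℂ (fun _ => ℂ) 2 α.1 ∘L PiLp.proj 2 (fun _ : ι => FockSpace k b) i

theorem IsElliptic.exists_estimate_coords (hk : 1 ≤ k) (h : b ≠ c)
    {f : RealSymbol k ι} (hf : f.IsElliptic) :
    ∃ (s : Finset (ParityIndex k b)) (C : ℝ), ∀ u : FockPow k b ι,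
      ‖u‖ ≤ C * (‖f.toOp h u‖ + ‖coords ι s u‖) := by
  classical
  obtain ⟨C, hC, hCu⟩ := hf.exists_estimate_dampOp hk h
  obtain ⟨d, hd⟩ := exists_nat_ge (4 * C ^ 2)
  set s : Finset (ParityIndex k b) := (finite_degree_lt k b d).toFinset with hs
  set K : ℝ := Fintype.card ι * s.card with hK
  have hK0 : 0 ≤ K := by positivity
  have hdamp : ∀ u : FockPow k b ι,
      ‖matOp 1 (dampOp k b) u‖ ≤ √K * ‖coords ι s u‖ + ‖u‖ / (2 * C) := by
    intro u
    refine le_of_sq_le_sq ?_ (by positivity)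
    have h1 : ‖matOp 1 (dampOp k b) u‖ ^ 2 ≤ K * ‖coords ι s u‖ ^ 2 + ‖u‖ ^ 2 / (d + 1) := by
      rw [PiLp.norm_sq_eq_of_L2, PiLp.norm_sq_eq_of_L2 _ u, Finset.sum_div]
      have h2 : ∀ i, ‖matOp 1 (dampOp k b) u i‖ ^ 2 ≤
          s.card * ‖coords ι s u‖ ^ 2 + ‖u i‖ ^ 2 / (d + 1) := by
        intro i
        have h3 : matOp 1 (dampOp k b) u i = dampOp k b (u i) := by simp [Matrix.one_apply]
        rw [h3]
        refine (sq_norm_dampOp_le d s (fun α hα => by simpa [hs] using hα) (u i)).trans ?_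
        gcongr
        refine (Finset.sum_le_card_nsmul _ _ (‖coords ι s u‖ ^ 2) fun α hα => ?_).trans
          (le_of_eq (nsmul_eq_mul _ _))
        gcongr
        exact (norm_le_pi_norm (coords ι s u i) ⟨α, hα⟩).trans (norm_le_pi_norm (coords ι s u) i)
      refine (Finset.sum_le_sum fun i _ => h2 i).trans (le_of_eq ?_)
      rw [Finset.sum_add_distrib]
      simp [hK, mul_assoc]
    have h4 : ‖u‖ ^ 2 / (d + 1) ≤ (‖u‖ / (2 * C)) ^ 2 := by
      rw [div_pow]
      gcongr
      nlinarith
    have h5 : K * ‖coords ι s u‖ ^ 2 = (√K * ‖coords ι s u‖) ^ 2 := by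
      rw [mul_pow, Real.sq_sqrt hK0]
    have h6 : 0 ≤ √K * ‖coords ι s u‖ := by positivity
    have h7 : 0 ≤ ‖u‖ / (2 * C) := by positivity
    nlinarith
  refine ⟨s, 2 * C * (1 + √K), fun u => ?_⟩
  have h1 := hCu u
  have h2 := mul_le_mul_of_nonneg_left (hdamp u) hC.le
  have h3 : C * (‖u‖ / (2 * C)) = ‖u‖ / 2 := by field_simp
  have h4 : 0 ≤ √K := Real.sqrt_nonneg _
  have h5 := norm_nonneg (f.toOp h u)
  have h6 := norm_nonneg (coords ι s u)
  have h7 : 0 ≤ C * √K * ‖f.toOp h u‖ := by positivity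
  have h8 : 0 ≤ C * ‖coords ι s u‖ := by positivity
  nlinarith

end RealSymbol

theorem star_dotProduct_self_eq {ι : Type*} [Fintype ι] (x : ι → ℂ) :
    star x ⬝ᵥ x = ((∑ i, ‖x i‖ ^ 2 : ℝ) : ℂ) := by
  simp [dotProduct, Complex.conj_mul']

theorem eq_zero_of_sum_sq_norm {ι : Type*} [Fintype ι] {x : ι → ℂ} (h : ∑ i, ‖x i‖ ^ 2 = 0) : x = 0 := by
  rw [Finset.sum_eq_zero_iff_of_nonneg fun i _ => by positivity] at h
  funext i
  simpa using h i (Finset.mem_univ i)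

namespace RealSymbol

section Double

variable {k : ℕ} {ι κ : Type*}

/-- The direct sum of two symbols. -/
def blockDiag (f : RealSymbol k ι) (g : RealSymbol k κ) : RealSymbol k (ι ⊕ κ) :=
  (fun j => Matrix.fromBlocks (f.1 j) 0 0 (g.1 j), fun j => Matrix.fromBlocks (f.2 j) 0 0 (g.2 j))

theorem conj_blockDiag (f : RealSymbol k ι) (g : RealSymbol k κ) :
    (f.blockDiag g).conj = f.conj.blockDiag g.conj := by
  simp [conj, blockDiag, Matrix.fromBlocks_conjTranspose]

theorem conj_add_smul (a : ℝ) (f g : RealSymbol k ι) (b : ℝ) :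
    ((a : ℂ) • f + (b : ℂ) • g).conj = (a : ℂ) • f.conj + (b : ℂ) • g.conj := by
  ext <;> simp [conj]

/-- The symbol `[f, -conj v_j; v_j, f*]` in which the variable `v_j` is removed from `f`. -/
def double [DecidableEq ι] (j : Fin k) (f : RealSymbol k ι) : RealSymbol k (ι ⊕ ι) :=
  (Function.update (f.blockDiag f.conj).1 j (Matrix.fromBlocks 0 0 1 0),
    Function.update (f.blockDiag f.conj).2 j (Matrix.fromBlocks 0 (-1) 0 0))

theorem eval_segment_double [DecidableEq ι] (j : Fin k) (f : RealSymbol k ι) (s : ℝ) (v : Fin k → ℂ) :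
    (((1 - s : ℝ) : ℂ) • f.blockDiag f.conj + (s : ℂ) • f.double j).eval v =
      Matrix.fromBlocks (f.eval (Function.update v j ((1 - s : ℝ) * v j)))
        (-(s * starRingEnd ℂ (v j)) • (1 : Matrix ι ι ℂ)) ((s * v j) • (1 : Matrix ι ι ℂ))
        (f.eval (Function.update v j ((1 - s : ℝ) * v j))).conjTranspose := by
  rw [← eval_conj]
  simp only [eval, ← Finset.add_sum_erase _ _ (Finset.mem_univ j)]
  have h1 : ∀ i ∈ Finset.univ.erase j,
      v i • (((1 - s : ℝ) : ℂ) • f.blockDiag f.conj + (s : ℂ) • f.double j).1 i +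
      starRingEnd ℂ (v i) • (((1 - s : ℝ) : ℂ) • f.blockDiag f.conj + (s : ℂ) • f.double j).2 i =
      Matrix.fromBlocks (v i • f.1 i + starRingEnd ℂ (v i) • f.2 i) 0 0
        (v i • f.conj.1 i + starRingEnd ℂ (v i) • f.conj.2 i) := by
    intro i hi
    have hij : i ≠ j := Finset.ne_of_mem_erase hi
    have h2 : ∀ M : Matrix (ι ⊕ ι) (ι ⊕ ι) ℂ, ((1 - s : ℝ) : ℂ) • M + (s : ℂ) • M = M := by
      intro M
      rw [← add_smul]
      simp
    simp only [Prod.fst_add, Prod.snd_add, Prod.smul_fst, Prod.smul_snd, Pi.add_apply,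
      Pi.smul_apply, double, Function.update_of_ne hij, h2]
    simp [blockDiag, Matrix.fromBlocks_smul, Matrix.fromBlocks_add]
  rw [Finset.sum_congr rfl h1]
  have h3 : ∀ (s : Finset (Fin k)) (P Q : Fin k → Matrix ι ι ℂ),
      ∑ i ∈ s, Matrix.fromBlocks (P i) 0 0 (Q i) =
        Matrix.fromBlocks (∑ i ∈ s, P i) 0 0 (∑ i ∈ s, Q i) := by
    intro s P Q
    ext (p | p) (q | q) <;> simp [Matrix.sum_apply]
  rw [h3]
  have h4 : ∀ g : RealSymbol k ι, ∑ i ∈ Finset.univ.erase j,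
      (Function.update v j ((1 - s : ℝ) * v j) i • g.1 i +
        starRingEnd ℂ (Function.update v j ((1 - s : ℝ) * v j) i) • g.2 i) =
      ∑ i ∈ Finset.univ.erase j, (v i • g.1 i + starRingEnd ℂ (v i) • g.2 i) := fun g =>
    Finset.sum_congr rfl fun i hi => by
      rw [Function.update_of_ne (Finset.ne_of_mem_erase hi)]
  rw [h4, h4]
  simp only [Prod.fst_add, Prod.snd_add, Prod.smul_fst, Prod.smul_snd, Pi.add_apply,
      Pi.smul_apply, double, Function.update_self, blockDiag, Matrix.fromBlocks_smul,
      Matrix.fromBlocks_add, map_mul, Complex.conj_ofReal]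
  congr 1
  · module
  · module
  · module
  · module

end Double

variable {k : ℕ} {ι κ : Type*} [Fintype ι] [Fintype κ] {b c : Bool}

theorem IsElliptic.finiteDimensional_ker (hk : 1 ≤ k) (h : b ≠ c) {f : RealSymbol k ι}
    (hf : f.IsElliptic) : FiniteDimensional ℂ (f.toOp h).ker := by
  obtain ⟨s, C, hC⟩ := hf.exists_estimate_coords hk h
  exact finiteDimensional_ker_of_estimate _ _ C hC

theorem IsElliptic.isClosed_range (hk : 1 ≤ k) (h : b ≠ c) {f : RealSymbol k ι}
    (hf : f.IsElliptic) : IsClosed ((f.toOp h).range : Set (FockPow k c ι)) := by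
  obtain ⟨s, C, hC⟩ := hf.exists_estimate_coords hk h
  exact isClosed_range_of_estimate _ _ C hC

/-- The cokernel of the operator of an elliptic symbol is the kernel of its conjugate. -/
noncomputable def IsElliptic.quotientEquiv (hk : 1 ≤ k) (h : b ≠ c) {f : RealSymbol k ι}
    (hf : f.IsElliptic) :
    (FockPow k c ι ⧸ (f.toOp h).range) ≃ₗ[ℂ] (f.conj.toOp h.symm).ker :=
  (quotientRangeEquivKerAdjoint _ (hf.isClosed_range hk h)).trans
    (LinearEquiv.ofEq _ _ (by rw [adjoint_toOp]))

theorem IsElliptic.finiteDimensional_quotient (hk : 1 ≤ k) (h : b ≠ c) {f : RealSymbol k ι}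
    (hf : f.IsElliptic) : FiniteDimensional ℂ (FockPow k c ι ⧸ (f.toOp h).range) :=
  have := hf.conj.finiteDimensional_ker hk h.symm
  (hf.quotientEquiv hk h).symm.finiteDimensional

/-- The index of a symbol. -/
noncomputable def index (f : RealSymbol k ι) : ℤ :=
  finrank ℂ (f.toOp Bool.false_ne_true).ker - finrank ℂ (f.conj.toOp Bool.false_ne_true.symm).ker

theorem IsElliptic.index_toOp (hk : 1 ≤ k) {f : RealSymbol k ι} (hf : f.IsElliptic) :
    (f.toOp Bool.false_ne_true).toLinearMap.index = f.index := by
  rw [LinearMap.index_eq_finrank_sub, index]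
  congr 2
  exact (hf.quotientEquiv hk _).finrank_eq

/-- The index is constant along a segment of elliptic symbols. -/
theorem index_eq_of_segment (hk : 1 ≤ k) (f g : RealSymbol k ι)
    (h : ∀ s : ℝ, (((1 - s : ℝ) : ℂ) • f + (s : ℂ) • g).IsElliptic) : f.index = g.index := by
  set F : ℝ → RealSymbol k ι := fun s => ((1 - s : ℝ) : ℂ) • f + (s : ℂ) • g with hF
  have hcont : Continuous fun s => (F s).toOp Bool.false_ne_true := by
    simp only [hF, toOp_add, toOp_smul]
    fun_prop
  have hloc : IsLocallyConstant fun s => (F s).index := by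
    rw [IsLocallyConstant.iff_eventually_eq]
    intro s
    have := (h s).finiteDimensional_ker hk Bool.false_ne_true
    have := (h s).finiteDimensional_quotient hk Bool.false_ne_true
    have h1 := eventually_index_eq _ ((h s).isClosed_range hk Bool.false_ne_true)
    filter_upwards [(hcont.tendsto s).eventually h1] with t ht
    have h2 := ht ((h t).finiteDimensional_ker hk _) ((h t).finiteDimensional_quotient hk _)
    rwa [(h t).index_toOp hk, (h s).index_toOp hk] at h2
  have h3 := hloc.apply_eq_of_preconnectedSpace 0 1
  simpa [hF] using h3

theorem toOp_blockDiag_inl (h : b ≠ c) (f : RealSymbol k ι) (g : RealSymbol k κ)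
    (u : FockPow k b (ι ⊕ κ)) (i : ι) :
    (f.blockDiag g).toOp h u (Sum.inl i) =
      f.toOp h (WithLp.toLp 2 fun i => u (Sum.inl i)) i := by
  simp [toOp_apply, blockDiag]

theorem toOp_blockDiag_inr (h : b ≠ c) (f : RealSymbol k ι) (g : RealSymbol k κ)
    (u : FockPow k b (ι ⊕ κ)) (i : κ) :
    (f.blockDiag g).toOp h u (Sum.inr i) =
      g.toOp h (WithLp.toLp 2 fun i => u (Sum.inr i)) i := by
  simp [toOp_apply, blockDiag]

/-- The kernel of a direct sum is the product of the kernels. -/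
noncomputable def kerBlockDiagEquiv (h : b ≠ c) (f : RealSymbol k ι) (g : RealSymbol k κ) :
    ((f.blockDiag g).toOp h).ker ≃ₗ[ℂ] (f.toOp h).ker × (g.toOp h).ker where
  toFun u :=
    (⟨WithLp.toLp 2 fun i => u.1 (Sum.inl i), by
      have hu : (f.blockDiag g).toOp h u.1 = 0 := u.2
      refine PiLp.ext fun i => ?_
      exact (toOp_blockDiag_inl h f g u.1 i).symm.trans (by rw [hu]; rfl)⟩,
    ⟨WithLp.toLp 2 fun i => u.1 (Sum.inr i), by
      have hu : (f.blockDiag g).toOp h u.1 = 0 := u.2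
      refine PiLp.ext fun i => ?_
      exact (toOp_blockDiag_inr h f g u.1 i).symm.trans (by rw [hu]; rfl)⟩)
  invFun w := ⟨WithLp.toLp 2 (Sum.elim w.1.1 w.2.1), by
    have h1 : f.toOp h w.1.1 = 0 := w.1.2
    have h2 : g.toOp h w.2.1 = 0 := w.2.2
    refine PiLp.ext fun i => ?_
    rcases i with i | i
    · exact (toOp_blockDiag_inl h f g _ i).trans (congrArg (fun v => v i) h1)
    · exact (toOp_blockDiag_inr h f g _ i).trans (congrArg (fun v => v i) h2)⟩
  map_add' _ _ := rfl
  map_smul' _ _ := rfl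
  left_inv u := Subtype.ext (PiLp.ext fun i => by rcases i with i | i <;> rfl)
  right_inv _ := rfl

theorem index_blockDiag (hk : 1 ≤ k) {f : RealSymbol k ι} {g : RealSymbol k κ}
    (hf : f.IsElliptic) (hg : g.IsElliptic) :
    (f.blockDiag g).index = f.index + g.index := by
  have := hf.finiteDimensional_ker hk Bool.false_ne_true
  have := hg.finiteDimensional_ker hk Bool.false_ne_true
  have := hf.conj.finiteDimensional_ker hk Bool.false_ne_true.symm
  have := hg.conj.finiteDimensional_ker hk Bool.false_ne_true.symm
  rw [index, index, index, conj_blockDiag, (kerBlockDiagEquiv _ f g).finrank_eq,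
    (kerBlockDiagEquiv _ f.conj g.conj).finrank_eq, finrank_prod, finrank_prod]
  push_cast
  ring

variable [DecidableEq ι]

theorem IsElliptic.segment_double (j : Fin k) {f : RealSymbol k ι} (hf : f.IsElliptic) (s : ℝ) :
    (((1 - s : ℝ) : ℂ) • f.blockDiag f.conj + (s : ℂ) • f.double j).IsElliptic := by
  intro v hv x hx
  rw [eval_segment_double] at hx
  set v' := Function.update v j ((1 - s : ℝ) * v j) with hv'
  set M := f.eval v' with hM
  obtain ⟨p, q, rfl⟩ : ∃ p q : ι → ℂ, x = Sum.elim p q :=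
    ⟨x ∘ Sum.inl, x ∘ Sum.inr, (Sum.elim_comp_inl_inr x).symm⟩
  rw [Matrix.fromBlocks_mulVec] at hx
  have h1 : M.mulVec p = (s * starRingEnd ℂ (v j)) • q := by
    have := congrArg (fun y => y ∘ Sum.inl) hx
    simp [Matrix.smul_mulVec, Matrix.neg_mulVec] at this
    linear_combination (exp := 1) this
  have h2 : M.conjTranspose.mulVec q = -(s * v j) • p := by
    have := congrArg (fun y => y ∘ Sum.inr) hx
    simp [Matrix.smul_mulVec] at this
    rw [neg_smul]
    exact eq_neg_of_add_eq_zero_right this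
  have h3 : star (M.mulVec p) ⬝ᵥ M.mulVec p = -((s * ‖v j‖) ^ 2 : ℝ) * (star p ⬝ᵥ p) := by
    rw [Matrix.star_mulVec, ← Matrix.dotProduct_mulVec]
    nth_rewrite 1 [h1]
    rw [Matrix.mulVec_smul, h2, dotProduct_smul, dotProduct_smul, smul_eq_mul, smul_eq_mul]
    have := Complex.conj_mul' (v j)
    push_cast
    linear_combination (-(s : ℂ) ^ 2 * (star p ⬝ᵥ p)) * this
  rw [star_dotProduct_self_eq, star_dotProduct_self_eq] at h3
  have h4 : (∑ i, ‖M.mulVec p i‖ ^ 2) = -((s * ‖v j‖) ^ 2) * ∑ i, ‖p i‖ ^ 2 := by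
    exact_mod_cast h3
  have h5 : 0 ≤ ∑ i, ‖M.mulVec p i‖ ^ 2 := Finset.sum_nonneg fun i _ => by positivity
  have h6 : 0 ≤ ∑ i, ‖p i‖ ^ 2 := Finset.sum_nonneg fun i _ => by positivity
  have h7 : M.mulVec p = 0 := eq_zero_of_sum_sq_norm (by nlinarith [sq_nonneg (s * ‖v j‖)])
  suffices h : p = 0 ∧ q = 0 by
    rw [h.1, h.2]
    exact Sum.elim_zero_zero
  by_cases hs : (s : ℂ) * v j = 0
  · have hvv : v' = v := by
      rw [hv', Function.update_eq_self_iff]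
      push_cast
      linear_combination -hs
    rw [hvv] at hM
    refine ⟨hf v hv p (hM ▸ h7), hf.conj v hv q ?_⟩
    rw [eval_conj, ← hM, h2, hs]
    simp
  · have hs' : (s : ℂ) * starRingEnd ℂ (v j) ≠ 0 := by
      intro h
      apply hs
      simpa using h
    constructor
    · refine eq_zero_of_sum_sq_norm ?_
      have h8 : 0 < (s * ‖v j‖) ^ 2 := by
        have h9 : s * ‖v j‖ ≠ 0 := by
          intro h
          apply hs
          simpa using h
        positivity
      nlinarith
    · rw [h7] at h1
      exact (smul_eq_zero.mp h1.symm).resolve_left hs'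

theorem IsElliptic.double (j : Fin k) {f : RealSymbol k ι} (hf : f.IsElliptic) :
    (f.double j).IsElliptic := by
  simpa using hf.segment_double j 1

theorem index_double (hk : 1 ≤ k) (j : Fin k) {f : RealSymbol k ι} (hf : f.IsElliptic) :
    (f.double j).index = f.index + f.conj.index := by
  rw [← index_blockDiag hk hf hf.conj]
  exact (index_eq_of_segment hk _ _ (hf.segment_double j)).symm

theorem index_conj_double (hk : 1 ≤ k) (j : Fin k) {f : RealSymbol k ι} (hf : f.IsElliptic) :
    (f.double j).conj.index = f.index + f.conj.index := by
  have h := index_eq_of_segment hk (f.blockDiag f.conj).conj (f.double j).conj fun s => by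
    rw [← conj_add_smul]
    exact (hf.segment_double j s).conj
  rw [← h, conj_blockDiag, conj_conj, index_blockDiag hk hf.conj hf, add_comm]

end RealSymbol

theorem Matrix.fromBlocks_neg_mul_fromBlocks {R ι : Type*} [Ring R] [Fintype ι]
    {A A' D X : Matrix ι ι R} (hD : D * A' = A' * D) (hX : X * A = A * X) :
    Matrix.fromBlocks A' D (-X) A * Matrix.fromBlocks A (-D) X A' =
      Matrix.fromBlocks (A' * A + D * X) 0 0 (X * D + A * A') := by
  simp [Matrix.fromBlocks_multiply, hD, hX]

theorem Matrix.fromBlocks_mul_fromBlocks_neg {R ι : Type*} [Ring R] [Fintype ι]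
    {A A' D X : Matrix ι ι R} (hD : D * A = A * D) (hX : X * A' = A' * X) :
    Matrix.fromBlocks A (-D) X A' * Matrix.fromBlocks A' D (-X) A =
      Matrix.fromBlocks (A * A' + D * X) 0 0 (X * D + A' * A) := by
  simp [Matrix.fromBlocks_multiply, hD, hX]

/-- Formal power series coefficients in `k` variables. -/
abbrev FormalCoeff (k : ℕ) : Type := (Fin k → ℕ) → ℂ

namespace FormalCoeff

variable {k : ℕ}

/-- Multiplication by the `j`-th variable. -/
def mulVar (j : Fin k) : Module.End ℂ (FormalCoeff k) where
  toFun c β := if β j = 0 then 0 else c (Function.update β j (β j - 1))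
  map_add' c d := by
    funext β
    by_cases h : β j = 0 <;> simp [h]
  map_smul' a c := by
    funext β
    by_cases h : β j = 0 <;> simp [h]

/-- Differentiation with respect to the `j`-th variable. -/
def derivVar (j : Fin k) : Module.End ℂ (FormalCoeff k) where
  toFun c β := (β j + 1) * c (Function.update β j (β j + 1))
  map_add' c d := by
    funext β
    simp [mul_add]
  map_smul' a c := by
    funext β
    simp [mul_left_comm]

/-- The diagonal operator with given entries. -/
def diagEnd : ((Fin k → ℕ) → ℂ) →+ Module.End ℂ (FormalCoeff k) where
  toFun w :=
    { toFun := fun c β => w β * c β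
      map_add' := fun c d => by funext β; simp [mul_add]
      map_smul' := fun a c => by funext β; simp [mul_left_comm] }
  map_zero' := by ext; simp
  map_add' w w' := by
    refine LinearMap.ext fun c => funext fun β => ?_
    simp [add_mul]

theorem mulVar_apply (j : Fin k) (c : FormalCoeff k) (β : Fin k → ℕ) :
    mulVar j c β = if β j = 0 then 0 else c (Function.update β j (β j - 1)) := rfl

theorem derivVar_apply (j : Fin k) (c : FormalCoeff k) (β : Fin k → ℕ) :
    derivVar j c β = (β j + 1) * c (Function.update β j (β j + 1)) := rfl

theorem diagEnd_apply (w : (Fin k → ℕ) → ℂ) (c : FormalCoeff k) (β : Fin k → ℕ) :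
    diagEnd w c β = w β * c β := rfl

theorem derivVar_mul_mulVar (j : Fin k) :
    derivVar j * mulVar j = diagEnd fun β => (β j + 1 : ℂ) := by
  refine LinearMap.ext fun c => funext fun β => ?_
  simp [Module.End.mul_apply, mulVar_apply, derivVar_apply, diagEnd_apply]

theorem mulVar_mul_derivVar (j : Fin k) :
    mulVar j * derivVar j = diagEnd fun β => (β j : ℂ) := by
  refine LinearMap.ext fun c => funext fun β => ?_
  by_cases h : β j = 0
  · simp [Module.End.mul_apply, mulVar_apply, diagEnd_apply, h]
  · have h1 : β j - 1 + 1 = β j := by omega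
    have h2 : ((β j - 1 : ℕ) : ℂ) + 1 = β j := by exact_mod_cast h1
    simp [Module.End.mul_apply, mulVar_apply, derivVar_apply, diagEnd_apply, h, h1, h2]

theorem commute_mulVar {i j : Fin k} (h : i ≠ j) : Commute (mulVar i) (mulVar j) := by
  refine LinearMap.ext fun c => funext fun β => ?_
  simp only [Module.End.mul_apply, mulVar_apply, Function.update_of_ne h, Function.update_of_ne h.symm,
    Function.update_comm h]
  split_ifs <;> rfl

theorem commute_derivVar {i j : Fin k} (h : i ≠ j) : Commute (derivVar i) (derivVar j) := by
  refine LinearMap.ext fun c => funext fun β => ?_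
  simp only [Module.End.mul_apply, derivVar_apply, Function.update_of_ne h,
    Function.update_of_ne h.symm, Function.update_comm h]
  ring

theorem commute_mulVar_derivVar {i j : Fin k} (h : i ≠ j) :
    Commute (mulVar i) (derivVar j) := by
  refine LinearMap.ext fun c => funext fun β => ?_
  simp only [Module.End.mul_apply, mulVar_apply, derivVar_apply, Function.update_of_ne h,
    Function.update_of_ne h.symm, Function.update_comm h]
  split_ifs <;> simp

end FormalCoeff

open FormalCoeff

namespace RealSymbol

variable {k : ℕ} {ι : Type*}

/-- The differential operator with symbol `f` in the variables of index in `T`. -/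
noncomputable def formalOp (T : Finset (Fin k)) (f : RealSymbol k ι) :
    Matrix ι ι (Module.End ℂ (FormalCoeff k)) :=
  fun p q => ∑ j ∈ T, (f.1 j p q • mulVar j + f.2 j p q • derivVar j)

theorem commute_formalOp {T : Finset (Fin k)} (f : RealSymbol k ι)
    (a : Module.End ℂ (FormalCoeff k)) (h1 : ∀ j ∈ T, Commute a (mulVar j))
    (h2 : ∀ j ∈ T, Commute a (derivVar j)) (p q : ι) : Commute a (f.formalOp T p q) :=
  Commute.sum_right _ _ _ fun j hj =>
    ((h1 j hj).smul_right _).add_right ((h2 j hj).smul_right _)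

theorem diagonal_mul_formalOp [Fintype ι] [DecidableEq ι] {T : Finset (Fin k)}
    (f : RealSymbol k ι) (a : Module.End ℂ (FormalCoeff k)) (h1 : ∀ j ∈ T, Commute a (mulVar j))
    (h2 : ∀ j ∈ T, Commute a (derivVar j)) :
    Matrix.diagonal (fun _ => a) * f.formalOp T = f.formalOp T * Matrix.diagonal fun _ => a := by
  ext1 p q
  rw [Matrix.diagonal_mul, Matrix.mul_diagonal]
  exact commute_formalOp f a h1 h2 p q

theorem formalOp_double [DecidableEq ι] {T : Finset (Fin k)} {j : Fin k} (hj : j ∉ T)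
    (f : RealSymbol k ι) :
    (f.double j).formalOp (insert j T) = Matrix.fromBlocks (f.formalOp T)
      (-Matrix.diagonal fun _ => derivVar j) (Matrix.diagonal fun _ => mulVar j)
      (f.conj.formalOp T) := by
  have h0 : ∀ i ∈ T, i ≠ j := fun i hi h => hj (h ▸ hi)
  ext1 p q
  rw [formalOp, Finset.sum_insert hj]
  have h1 : ∀ i ∈ T, ((f.double j).1 i p q • mulVar i + (f.double j).2 i p q • derivVar i) =
      ((f.blockDiag f.conj).1 i p q • mulVar i + (f.blockDiag f.conj).2 i p q • derivVar i) := by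
    intro i hi
    simp [double, Function.update_of_ne (h0 i hi)]
  rw [Finset.sum_congr rfl h1]
  rcases p with p | p <;> rcases q with q | q <;>
    simp [double, blockDiag, formalOp, Matrix.diagonal_apply, Matrix.one_apply]
  all_goals rcases eq_or_ne p q with rfl | h <;> simp [*, Ne.symm]
  exact neg_one_smul ℂ (derivVar j)

theorem formalOp_conj_double [DecidableEq ι] {T : Finset (Fin k)} {j : Fin k} (hj : j ∉ T)
    (f : RealSymbol k ι) :
    (f.double j).conj.formalOp (insert j T) = Matrix.fromBlocks (f.conj.formalOp T)
      (Matrix.diagonal fun _ => derivVar j) (-Matrix.diagonal fun _ => mulVar j)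
      (f.formalOp T) := by
  have h0 : ∀ i ∈ T, i ≠ j := fun i hi h => hj (h ▸ hi)
  ext1 p q
  rw [formalOp, Finset.sum_insert hj]
  have h1 : ∀ i ∈ T, ((f.double j).conj.1 i p q • mulVar i +
      (f.double j).conj.2 i p q • derivVar i) =
      ((f.conj.blockDiag f).1 i p q • mulVar i + (f.conj.blockDiag f).2 i p q • derivVar i) := by
    intro i hi
    rcases p with p | p <;> rcases q with q | q <;>
      simp [double, conj, blockDiag, Function.update_of_ne (h0 i hi)]
  rw [Finset.sum_congr rfl h1]
  rcases p with p | p <;> rcases q with q | q <;>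
    simp [double, conj, blockDiag, formalOp, Matrix.diagonal_apply, Matrix.one_apply]
  all_goals rcases eq_or_ne p q with rfl | h <;> simp [*, Ne.symm]
  exact neg_one_smul ℂ (mulVar j)

/-- The number operator of the variables in `T`, shifted by `m` on each component. -/
noncomputable def numberOp [DecidableEq ι] (T : Finset (Fin k)) (m : ι → ℕ) :
    Matrix ι ι (Module.End ℂ (FormalCoeff k)) :=
  Matrix.diagonal fun p => diagEnd fun β => ((∑ i ∈ T, β i + m p : ℕ) : ℂ)

/-- A symbol whose operators in the variables in `T` square to shifted number operators. -/
structure IsSquareRoot [Fintype ι] [DecidableEq ι] (T : Finset (Fin k)) (f : RealSymbol k ι)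
    (m m' : ι → ℕ) : Prop where
  conj_mul_self : f.conj.formalOp T * f.formalOp T = numberOp T m
  self_mul_conj : f.formalOp T * f.conj.formalOp T = numberOp T m'

theorem IsSquareRoot.conj [Fintype ι] [DecidableEq ι] {T : Finset (Fin k)} {f : RealSymbol k ι}
    {m m' : ι → ℕ} (h : IsSquareRoot T f m m') : IsSquareRoot T f.conj m' m :=
  ⟨by rw [conj_conj]; exact h.2, by rw [conj_conj]; exact h.1⟩

theorem isSquareRoot_empty [Fintype ι] [DecidableEq ι] (f : RealSymbol k ι) :
    IsSquareRoot ∅ f (fun _ => 0) fun _ => 0 := by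
  have h0 : (diagEnd fun _ => (0 : ℂ)) = (0 : Module.End ℂ (FormalCoeff k)) := map_zero diagEnd
  have h1 : ∀ g : RealSymbol k ι, g.formalOp ∅ = 0 := fun g => by ext1 p q; simp [formalOp]
  constructor <;> simp [h1, numberOp, h0]

theorem IsSquareRoot.double [Fintype ι] [DecidableEq ι] {T : Finset (Fin k)} {f : RealSymbol k ι}
    {m m' : ι → ℕ} (h : IsSquareRoot T f m m') {j : Fin k} (hj : j ∉ T) :
    IsSquareRoot (insert j T) (f.double j) (Sum.elim (fun p => m p + 1) m')
      (Sum.elim (fun p => m' p + 1) m) := by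
  have h0 : ∀ i ∈ T, i ≠ j := fun i hi h => hj (h ▸ hi)
  have hX : ∀ g : RealSymbol k ι, Matrix.diagonal (fun _ => mulVar j) * g.formalOp T =
      g.formalOp T * Matrix.diagonal fun _ => mulVar j := fun g =>
    diagonal_mul_formalOp g _ (fun i hi => commute_mulVar (h0 i hi).symm)
      fun i hi => commute_mulVar_derivVar (h0 i hi).symm
  have hD : ∀ g : RealSymbol k ι, Matrix.diagonal (fun _ => derivVar j) * g.formalOp T =
      g.formalOp T * Matrix.diagonal fun _ => derivVar j := fun g =>
    diagonal_mul_formalOp g _ (fun i hi => (commute_mulVar_derivVar (h0 i hi)).symm)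
      fun i hi => commute_derivVar (h0 i hi).symm
  have hN : ∀ m m' : ι → ℕ, numberOp (insert j T) (Sum.elim (fun p => m p + 1) m') =
      Matrix.fromBlocks (numberOp T m + Matrix.diagonal fun _ => derivVar j * mulVar j) 0 0
        (Matrix.diagonal (fun _ => mulVar j * derivVar j) + numberOp T m') := by
    intro m m'
    simp only [numberOp, Matrix.diagonal_add, Matrix.fromBlocks_diagonal, derivVar_mul_mulVar,
      mulVar_mul_derivVar, ← map_add]
    congr 1
    funext p
    rcases p with p | p <;> simp only [Sum.elim_inl, Sum.elim_inr] <;> congr 1 <;> funext β <;>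
      simp [Finset.sum_insert hj] <;> ring
  constructor
  · rw [formalOp_double hj, formalOp_conj_double hj, hN, ← h.conj_mul_self, ← h.self_mul_conj,
      ← Matrix.diagonal_mul_diagonal, ← Matrix.diagonal_mul_diagonal]
    exact Matrix.fromBlocks_neg_mul_fromBlocks (hD _) (hX _)
  · rw [formalOp_double hj, formalOp_conj_double hj, hN, ← h.conj_mul_self, ← h.self_mul_conj,
      ← Matrix.diagonal_mul_diagonal, ← Matrix.diagonal_mul_diagonal]
    exact Matrix.fromBlocks_mul_fromBlocks_neg (hD _) (hX _)

theorem IsElliptic.exists_isSquareRoot {ι : Type} [Fintype ι] [DecidableEq ι] (hk : 1 ≤ k)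
    {f : RealSymbol k ι} (hf : f.IsElliptic) (T : Finset (Fin k)) :
    ∃ (κ : Type) (_ : Fintype κ) (_ : DecidableEq κ) (g : RealSymbol k κ) (m m' : κ → ℕ),
      g.IsElliptic ∧ IsSquareRoot T g m m' ∧ Nat.card {p // m p = 0} = Fintype.card ι ∧
      Nat.card {p // m' p = 0} = Fintype.card ι ∧
      g.index + g.conj.index = 2 ^ T.card * (f.index + f.conj.index) := by
  classical
  induction T using Finset.induction_on with
  | empty =>
    exact ⟨ι, inferInstance, inferInstance, f, _, _, hf, isSquareRoot_empty f, by simp, by simp,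
      by simp⟩
  | insert j T hj ih =>
    obtain ⟨κ, _, _, g, m, m', hg, hsq, hm, hm', hi⟩ := ih
    refine ⟨κ ⊕ κ, inferInstance, inferInstance, g.double j, _, _, hg.double j, hsq.double hj,
      ?_, ?_, ?_⟩
    · rw [← hm', Nat.card_congr Equiv.subtypeSum, Nat.card_sum]
      simp
    · rw [← hm, Nat.card_congr Equiv.subtypeSum, Nat.card_sum]
      simp
    · rw [index_double hk j hg, index_conj_double hk j hg, hi, Finset.card_insert_of_notMem hj]
      ring

end RealSymbol

/-- The radial factor relating the Fock space to formal power series. -/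
noncomputable def radialWeight : ℕ → ℝ
  | 0 => 1
  | 1 => 1
  | n + 2 => radialWeight n * (√(n + 1) / √(n + 2))

theorem radialWeight_pos : ∀ n, 0 < radialWeight n
  | 0 => one_pos
  | 1 => one_pos
  | n + 2 => mul_pos (radialWeight_pos n) (by positivity)

theorem sqrt_mul_radialWeight (n : ℕ) :
    √((n : ℝ) + 2) * radialWeight (n + 2) = √(n + 1) * radialWeight n := by
  rw [radialWeight]
  have : √((n : ℝ) + 2) ≠ 0 := by positivity
  field_simp

section Weight

variable {k : ℕ}

/-- The normalization of the monomials. -/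
noncomputable def sqrtFactorial (β : Fin k → ℕ) : ℝ := ∏ i, √((β i).factorial : ℝ)

theorem sqrtFactorial_pos (β : Fin k → ℕ) : 0 < sqrtFactorial β :=
  Finset.prod_pos fun i _ => Real.sqrt_pos.mpr (by exact_mod_cast Nat.factorial_pos _)

theorem sqrtFactorial_update (β : Fin k → ℕ) (j : Fin k) :
    sqrtFactorial (Function.update β j (β j + 1)) = √(β j + 1) * sqrtFactorial β := by
  rw [sqrtFactorial, sqrtFactorial, ← Finset.mul_prod_erase _ _ (Finset.mem_univ j),
    ← Finset.mul_prod_erase Finset.univ (fun i => √((β i).factorial : ℝ)) (Finset.mem_univ j),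
    Function.update_self, Nat.factorial_succ, Nat.cast_mul, Real.sqrt_mul (by positivity),
    Nat.cast_succ, mul_assoc]
  congr 2
  refine Finset.prod_congr rfl fun i hi => ?_
  rw [Function.update_of_ne (Finset.ne_of_mem_erase hi)]

theorem sum_update_succ (β : Fin k → ℕ) (j : Fin k) :
    ∑ i, Function.update β j (β j + 1) i = ∑ i, β i + 1 := by
  rw [Finset.sum_update_of_mem (Finset.mem_univ j), ← Finset.add_sum_erase _ _ (Finset.mem_univ j),
    Finset.sdiff_singleton_eq_erase]
  ring

/-- The weight embedding the Fock space in formal power series. -/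
noncomputable def fockWeight (β : Fin k → ℕ) : ℝ := radialWeight (∑ i, β i) / sqrtFactorial β

/-- The weight with which Fock space operators are read off on formal power series. -/
noncomputable def coWeight (β : Fin k → ℕ) : ℝ :=
  sqrtFactorial β / (√(∑ i, β i + 1 : ℕ) * radialWeight (∑ i, β i + 1))

theorem fockWeight_pos (β : Fin k → ℕ) : 0 < fockWeight β :=
  div_pos (radialWeight_pos _) (sqrtFactorial_pos β)

theorem coWeight_pos (β : Fin k → ℕ) : 0 < coWeight β :=
  div_pos (sqrtFactorial_pos β) (mul_pos (Real.sqrt_pos.mpr (by positivity)) (radialWeight_pos _))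

theorem coWeight_mul_fockWeight_update (β : Fin k → ℕ) (j : Fin k) :
    coWeight β * ((β j + 1) * fockWeight (Function.update β j (β j + 1))) =
      √((β j + 1) / (∑ i, β i + 1 : ℕ)) := by
  rw [coWeight, fockWeight, sum_update_succ, sqrtFactorial_update, Real.sqrt_div (by positivity)]
  have h1 := (sqrtFactorial_pos β).ne'
  have h2 := (radialWeight_pos (∑ i, β i + 1)).ne'
  have h3 : √((β j : ℝ) + 1) ≠ 0 := by positivity
  have h4 : √((∑ i, β i + 1 : ℕ) : ℝ) ≠ 0 := by positivity
  have h5 : (β j : ℝ) + 1 = √((β j : ℝ) + 1) * √((β j : ℝ) + 1) :=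
    (Real.mul_self_sqrt (by positivity)).symm
  nth_rewrite 1 [h5]
  field_simp

theorem coWeight_update_mul_fockWeight (β : Fin k → ℕ) (j : Fin k) :
    coWeight (Function.update β j (β j + 1)) * fockWeight β =
      √((β j + 1) / (∑ i, β i + 1 : ℕ)) := by
  have h0 := sqrt_mul_radialWeight (∑ i, β i)
  have h0' : ((∑ i, β i + 1 + 1 : ℕ) : ℝ) = ((∑ i, β i : ℕ) : ℝ) + 2 := by push_cast; ring
  rw [coWeight, fockWeight, sum_update_succ, sqrtFactorial_update, Real.sqrt_div (by positivity),
    h0', h0, Nat.cast_succ]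
  have h1 := (sqrtFactorial_pos β).ne'
  have h2 := (radialWeight_pos (∑ i, β i)).ne'
  have h4 : √(((∑ i, β i : ℕ) : ℝ) + 1) ≠ 0 := by positivity
  field_simp

end Weight

section Embedding

variable {k : ℕ} {b c : Bool}

theorem ParityIndex.raise_val (h : b ≠ c) (j : Fin k) (α : ParityIndex k b) :
    (raise h j α).1 = Function.update α.1 j (α.1 j + 1) := by
  funext i
  rcases eq_or_ne i j with rfl | hi
  · simp [raise]
  · simp [raise, hi]

/-- The formal power series of an element of the Fock space. -/
noncomputable def fockSeries (u : FockSpace k b) : FormalCoeff k :=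
  fun β => if h : (∑ i, β i).bodd = b then fockWeight β * u ⟨β, h⟩ else 0

theorem fockSeries_apply (u : FockSpace k b) (α : ParityIndex k b) :
    fockSeries u α.1 = fockWeight α.1 * u α := dif_pos α.2

theorem fockSeries_apply_of_ne (h : b ≠ c) (u : FockSpace k b) (α : ParityIndex k c) :
    fockSeries u α.1 = 0 := dif_neg fun hα => h (hα.symm.trans α.2)

theorem lowerOp_apply_eq (h : b ≠ c) (j : Fin k) (u : FockSpace k b) (β : ParityIndex k c) :
    lowerOp h.symm j u β = coWeight β.1 * derivVar j (fockSeries u) β.1 := by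
  rw [lowerOp_apply, derivVar_apply, ← raise_val h.symm, fockSeries_apply, raise_val, shiftWeight]
  have := coWeight_mul_fockWeight_update β.1 j
  rw [Nat.cast_succ] at this
  rw [degree, ← this]
  push_cast
  ring

theorem raiseOp_apply_eq (h : b ≠ c) (j : Fin k) (u : FockSpace k b) (β : ParityIndex k c) :
    raiseOp h j u β = coWeight β.1 * mulVar j (fockSeries u) β.1 := by
  rcases Nat.eq_zero_or_pos (β.1 j) with hβ | hβ
  · rw [raiseOp_apply_eq_zero h j u β hβ, mulVar_apply, if_pos hβ, mul_zero]
  · obtain ⟨α, rfl⟩ := exists_raise_eq h j β hβ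
    have h1 : Function.update (raise h j α).1 j ((raise h j α).1 j - 1) = α.1 := by
      simp [raise_val]
    rw [raiseOp_apply_raise, mulVar_apply, if_neg hβ.ne', h1, fockSeries_apply, raise_val,
      shiftWeight]
    have := coWeight_update_mul_fockWeight α.1 j
    rw [Nat.cast_succ] at this
    rw [degree, ← this]
    push_cast
    ring

theorem derivVar_fockSeries_of_eq (h : b ≠ c) (j : Fin k) (u : FockSpace k b)
    (β : ParityIndex k b) : derivVar j (fockSeries u) β.1 = 0 := by
  rw [derivVar_apply, ← raise_val h, fockSeries_apply_of_ne h, mul_zero]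

theorem mulVar_fockSeries_of_eq (h : b ≠ c) (j : Fin k) (u : FockSpace k b)
    (β : ParityIndex k b) : mulVar j (fockSeries u) β.1 = 0 := by
  rw [mulVar_apply]
  split_ifs with hβ
  · rfl
  · obtain ⟨α, rfl⟩ := exists_raise_eq h.symm j β (Nat.pos_of_ne_zero hβ)
    have h1 : Function.update (raise h.symm j α).1 j ((raise h.symm j α).1 j - 1) = α.1 := by
      simp [raise_val]
    rw [h1, fockSeries_apply_of_ne h]

end Embedding

namespace RealSymbol

variable {k : ℕ} {ι : Type*} [Fintype ι] {b c : Bool}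

/-- The action of a matrix of endomorphisms on vectors of formal power series. -/
def matAct (M : Matrix ι ι (Module.End ℂ (FormalCoeff k))) (w : ι → FormalCoeff k) :
    ι → FormalCoeff k :=
  fun p => ∑ q, M p q (w q)

theorem matAct_mul (M N : Matrix ι ι (Module.End ℂ (FormalCoeff k))) (w : ι → FormalCoeff k) :
    matAct (M * N) w = matAct M (matAct N w) := by
  funext p
  simp only [matAct, Matrix.mul_apply, LinearMap.sum_apply, map_sum, Module.End.mul_apply]
  exact Finset.sum_comm

theorem matAct_zero (M : Matrix ι ι (Module.End ℂ (FormalCoeff k))) : matAct M 0 = 0 := by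
  funext p
  simp [matAct]

theorem matAct_numberOp [DecidableEq ι] (T : Finset (Fin k)) (m : ι → ℕ)
    (w : ι → FormalCoeff k) (p : ι) (β : Fin k → ℕ) :
    matAct (numberOp T m) w p β = (∑ i ∈ T, β i + m p : ℕ) * w p β := by
  rw [matAct, Finset.sum_eq_single p, numberOp, Matrix.diagonal_apply_eq, diagEnd_apply]
  · intro q _ hq
    rw [numberOp, Matrix.diagonal_apply_ne _ hq.symm, LinearMap.zero_apply]
  · simp

theorem matAct_formalOp_apply (f : RealSymbol k ι) (w : ι → FormalCoeff k) (p : ι)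
    (β : Fin k → ℕ) : matAct (f.formalOp Finset.univ) w p β =
      ∑ j, ((∑ q, f.1 j p q * mulVar j (w q) β) + ∑ q, f.2 j p q * derivVar j (w q) β) := by
  simp only [matAct, formalOp, LinearMap.sum_apply, LinearMap.add_apply, LinearMap.smul_apply,
    Finset.sum_apply, Pi.add_apply, Pi.smul_apply, smul_eq_mul]
  rw [Finset.sum_comm]
  simp_rw [Finset.sum_add_distrib]

theorem toOp_apply_eq (h : b ≠ c) (f : RealSymbol k ι) (u : FockPow k b ι) (p : ι)
    (β : ParityIndex k c) : f.toOp h u p β =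
      coWeight β.1 * matAct (f.formalOp Finset.univ) (fun q => fockSeries (u q)) p β.1 := by
  rw [toOp_apply, matAct_formalOp_apply]
  simp only [lp.coeFn_sum, lp.coeFn_add, lp.coeFn_smul, Finset.sum_apply, Pi.add_apply,
    Pi.smul_apply, smul_eq_mul, raiseOp_apply_eq h, lowerOp_apply_eq h, Finset.mul_sum, mul_add]
  refine Finset.sum_congr rfl fun j _ => ?_
  congr 1 <;> refine Finset.sum_congr rfl fun q _ => ?_ <;> ring

theorem matAct_formalOp_fockSeries_of_eq (h : b ≠ c) (f : RealSymbol k ι) (u : FockPow k b ι)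
    (p : ι) (β : ParityIndex k b) :
    matAct (f.formalOp Finset.univ) (fun q => fockSeries (u q)) p β.1 = 0 := by
  rw [matAct_formalOp_apply]
  simp [mulVar_fockSeries_of_eq h, derivVar_fockSeries_of_eq h]

theorem toOp_eq_zero_iff (h : b ≠ c) (f : RealSymbol k ι) (u : FockPow k b ι) :
    f.toOp h u = 0 ↔ matAct (f.formalOp Finset.univ) (fun q => fockSeries (u q)) = 0 := by
  constructor
  · intro hu
    funext p β
    by_cases hβ : (∑ i, β i).bodd = c
    · have h1 := toOp_apply_eq h f u p ⟨β, hβ⟩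
      rw [hu] at h1
      have h2 : (coWeight β : ℂ) ≠ 0 := Complex.ofReal_ne_zero.mpr (coWeight_pos β).ne'
      exact (mul_eq_zero.mp h1.symm).resolve_left h2
    · refine matAct_formalOp_fockSeries_of_eq h f u p ⟨β, ?_⟩
      revert h hβ
      cases (∑ i, β i).bodd <;> cases b <;> cases c <;> simp
  · intro hu
    refine PiLp.ext fun p => lp.ext (funext fun β => ?_)
    rw [toOp_apply_eq h, hu]
    simp

variable [DecidableEq ι]

theorem IsSquareRoot.apply_eq_zero {f : RealSymbol k ι} {m m' : ι → ℕ}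
    (hf : IsSquareRoot Finset.univ f m m') (h : b ≠ c) {u : FockPow k b ι}
    (hu : f.toOp h u = 0) (p : ι) (α : ParityIndex k b) (hα : α.degree + m p ≠ 0) :
    u p α = 0 := by
  have h1 := (toOp_eq_zero_iff h f u).mp hu
  have h2 := matAct_numberOp Finset.univ m (fun q => fockSeries (u q)) p α.1
  rw [← hf.conj_mul_self, matAct_mul, h1, matAct_zero, fockSeries_apply] at h2
  have h3 : (fockWeight α.1 : ℂ) ≠ 0 := Complex.ofReal_ne_zero.mpr (fockWeight_pos α.1).ne'
  have h4 : ((∑ i, α.1 i + m p : ℕ) : ℂ) ≠ 0 := by exact_mod_cast hα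
  have h5 : ((∑ i, α.1 i + m p : ℕ) : ℂ) * (fockWeight α.1 * u p α) = 0 := h2.symm
  exact (mul_eq_zero.mp ((mul_eq_zero.mp h5).resolve_left h4)).resolve_left h3

theorem IsSquareRoot.ker_eq_bot {f : RealSymbol k ι} {m m' : ι → ℕ}
    (hf : IsSquareRoot Finset.univ f m m') : (f.toOp Bool.false_ne_true.symm).ker = ⊥ := by
  refine LinearMap.ker_eq_bot'.mpr fun u hu => PiLp.ext fun p => lp.ext (funext fun α => ?_)
  refine hf.apply_eq_zero Bool.false_ne_true.symm hu p α fun h0 => ?_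
  have h1 : α.degree = 0 := by omega
  have h2 := α.2
  rw [show ∑ i, α.1 i = 0 from h1] at h2
  simp at h2

/-- The zero multi-index. -/
def _root_.ParityIndex.zero (k : ℕ) : ParityIndex k false := ⟨0, by simp⟩

theorem _root_.ParityIndex.eq_zero {α : ParityIndex k false} (hα : α.degree = 0) :
    α = ParityIndex.zero k := by
  refine Subtype.ext (funext fun i => ?_)
  have := apply_le_degree α i
  simp only [ParityIndex.zero, Pi.zero_apply]
  omega

theorem IsSquareRoot.toOp_eq_zero {f : RealSymbol k ι} {m m' : ι → ℕ}
    (hf : IsSquareRoot Finset.univ f m m') {u : FockPow k false ι}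
    (hu : ∀ p α, α.degree + m p ≠ 0 → u p α = 0) : f.toOp Bool.false_ne_true u = 0 := by
  rw [toOp_eq_zero_iff]
  set w : ι → FormalCoeff k := fun q => fockSeries (u q) with hw
  have h1 : matAct (f.conj.formalOp Finset.univ) (matAct (f.formalOp Finset.univ) w) = 0 := by
    rw [← matAct_mul, hf.conj_mul_self]
    funext p β
    rw [matAct_numberOp]
    by_cases hβ : (∑ i, β i).bodd = false
    · by_cases h0 : ∑ i, β i + m p = 0
      · rw [h0]
        simp
      · have h2 : w p β = fockWeight β * u p ⟨β, hβ⟩ := fockSeries_apply (u p) ⟨β, hβ⟩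
        rw [h2, hu p ⟨β, hβ⟩ h0]
        simp
    · have h2 : w p β = 0 :=
        fockSeries_apply_of_ne Bool.false_ne_true (u p) ⟨β, by simpa using hβ⟩
      simp [h2]
  have h3 := congrArg (matAct (f.formalOp Finset.univ)) h1
  rw [← matAct_mul, hf.self_mul_conj, matAct_zero] at h3
  funext p β
  rcases Nat.eq_zero_or_pos (∑ i, β i) with hβ | hβ
  · exact matAct_formalOp_fockSeries_of_eq Bool.false_ne_true f u p ⟨β, by simp [hβ]⟩
  · have h4 := congrFun (congrFun h3 p) β
    rw [matAct_numberOp] at h4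
    have h5 : ((∑ i, β i + m' p : ℕ) : ℂ) ≠ 0 := by
      rw [Nat.cast_ne_zero]
      omega
    exact (mul_eq_zero.mp h4).resolve_left h5

theorem IsSquareRoot.finrank_ker {f : RealSymbol k ι} {m m' : ι → ℕ}
    (hf : IsSquareRoot Finset.univ f m m') :
    finrank ℂ (f.toOp Bool.false_ne_true).ker = Nat.card {p // m p = 0} := by
  classical
  let e : (f.toOp Bool.false_ne_true).ker →ₗ[ℂ] ({p // m p = 0} → ℂ) :=
    { toFun := fun u p => u.1 p.1 (ParityIndex.zero k)
      map_add' := fun u v => rfl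
      map_smul' := fun a u => rfl }
  have he : Function.Bijective e := by
    constructor
    · refine (injective_iff_map_eq_zero e).mpr fun u hu => Subtype.ext ?_
      refine PiLp.ext fun p => lp.ext (funext fun α => ?_)
      by_cases h0 : α.degree + m p = 0
      · have h1 : α = ParityIndex.zero k := ParityIndex.eq_zero (by omega)
        rw [h1]
        exact congrFun hu ⟨p, by omega⟩
      · exact hf.apply_eq_zero Bool.false_ne_true u.2 p α h0
    · intro x
      let u : FockPow k false ι := WithLp.toLp 2 fun p =>
        if hp : m p = 0 then lp.single 2 (ParityIndex.zero k) (x ⟨p, hp⟩) else 0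
      have hu : ∀ p, u p =
        if hp : m p = 0 then lp.single 2 (ParityIndex.zero k) (x ⟨p, hp⟩) else 0 := fun p => rfl
      refine ⟨⟨u, hf.toOp_eq_zero fun p α hα => ?_⟩, funext fun p => ?_⟩
      · rw [hu]
        split_ifs with hp
        · have h1 : α ≠ ParityIndex.zero k := by
            rintro rfl
            exact hα (by simp [hp, ParityIndex.zero, degree])
          simp [lp.single_apply, h1]
        · rfl
      · change u p.1 (ParityIndex.zero k) = x p
        rw [hu, dif_pos p.2]
        simp
  rw [(LinearEquiv.ofBijective e he).finrank_eq, finrank_fintype_fun_eq_card,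
    Nat.card_eq_fintype_card]

theorem IsSquareRoot.index_eq {f : RealSymbol k ι} {m m' : ι → ℕ}
    (hf : IsSquareRoot Finset.univ f m m') : f.index = Nat.card {p // m p = 0} := by
  rw [index, hf.finrank_ker, hf.conj.ker_eq_bot, finrank_bot]
  simp

/-- The size of an elliptic symbol in `k` complex variables is divisible by `2 ^ (k - 1)`. -/
theorem IsElliptic.two_pow_dvd {ι : Type} [Fintype ι] (hk : 1 ≤ k) {f : RealSymbol k ι}
    (hf : f.IsElliptic) : 2 ^ k ∣ 2 * Fintype.card ι := by
  classical
  obtain ⟨κ, _, _, g, m, m', -, hsq, hm, hm', hi⟩ := hf.exists_isSquareRoot hk Finset.univ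
  rw [hsq.index_eq, hsq.conj.index_eq, hm, hm', Finset.card_univ, Fintype.card_fin] at hi
  have : ((2 ^ k : ℕ) : ℤ) ∣ ((2 * Fintype.card ι : ℕ) : ℤ) := by
    refine ⟨f.index + f.conj.index, ?_⟩
    push_cast
    rw [← hi]
    ring
  exact_mod_cast this

end RealSymbol

/-- A family of invertible real matrices of size `n ≥ 2` depending linearly on `n` parameters
exists only for even `n`. -/
theorem even_of_forall_det_ne_zero {n : ℕ} (hn : 2 ≤ n)
    (G : (Fin n → ℝ) →ₗ[ℝ] Matrix (Fin n) (Fin n) ℝ) (hG : ∀ v, v ≠ 0 → (G v).det ≠ 0) :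
    Even n := by
  by_contra hodd
  rw [Nat.not_even_iff_odd] at hodd
  have hcont : Continuous fun v => (G v).det := G.continuous_of_finiteDimensional.matrix_det
  have hconn : IsPreconnected ({0}ᶜ : Set (Fin n → ℝ)) :=
    (isConnected_compl_singleton_of_one_lt_rank (by
      rw [rank_fun', Fintype.card_fin]
      exact_mod_cast hn) 0).isPreconnected
  have hneg : ∀ v, (G (-v)).det = -(G v).det := fun v => by
    rw [map_neg, Matrix.det_neg, Fintype.card_fin, hodd.neg_one_pow, neg_one_mul]
  have hsign : ∀ v, v ≠ 0 → 0 < (G v).det → False := fun v hv hpos => by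
    obtain ⟨w, hw, hw0⟩ := hconn.intermediate_value (a := -v) (b := v) (by simpa using hv)
      (by simpa using hv) hcont.continuousOn
      (show (0 : ℝ) ∈ Set.Icc (G (-v)).det (G v).det by
        rw [hneg]
        constructor <;> linarith)
    exact hG w hw hw0
  have hv : (fun _ : Fin n => (1 : ℝ)) ≠ 0 := fun h => by
    simpa using congrFun h ⟨0, by omega⟩
  rcases lt_or_gt_of_ne (hG _ hv) with h | h
  · exact hsign (-fun _ => 1) (neg_ne_zero.mpr hv) (by rw [hneg]; linarith)
  · exact hsign _ hv h

/-- The symbol of a real linear family of matrices on `ℂ ^ k`. -/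
noncomputable def RealSymbol.ofLinear {k : ℕ} {ι : Type*}
    (G : (Fin k ⊕ Fin k → ℝ) →ₗ[ℝ] Matrix ι ι ℝ) : RealSymbol k ι :=
  (fun j => (1 / 2 : ℂ) • ((G (Pi.single (Sum.inl j) 1)).map Complex.ofReal -
      Complex.I • (G (Pi.single (Sum.inr j) 1)).map Complex.ofReal),
    fun j => (1 / 2 : ℂ) • ((G (Pi.single (Sum.inl j) 1)).map Complex.ofReal +
      Complex.I • (G (Pi.single (Sum.inr j) 1)).map Complex.ofReal))

theorem RealSymbol.eval_ofLinear {k : ℕ} {ι : Type*}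
    (G : (Fin k ⊕ Fin k → ℝ) →ₗ[ℝ] Matrix ι ι ℝ) (v : Fin k → ℂ) :
    (RealSymbol.ofLinear G).eval v =
      (G (Sum.elim (fun j => (v j).re) fun j => (v j).im)).map Complex.ofReal := by
  ext p q
  have h1 := congrFun (congrFun (LinearMap.pi_apply_eq_sum_univ G
    (Sum.elim (fun j => (v j).re) fun j => (v j).im)) p) q
  rw [Matrix.map_apply, h1]
  simp only [eval, ofLinear, Fintype.sum_sum_type, Matrix.sum_apply, Matrix.add_apply,
    Matrix.smul_apply, Matrix.sub_apply, Matrix.map_apply, Sum.elim_inl, Sum.elim_inr,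
    smul_eq_mul, Complex.ofReal_add, Complex.ofReal_sum, Complex.ofReal_mul,
    ← Finset.sum_add_distrib]
  refine Finset.sum_congr rfl fun j _ => ?_
  have h2 : ∀ s : Fin k ⊕ Fin k,
      (fun i => if s = i then (1 : ℝ) else 0) = Pi.single s 1 := fun s => by
    funext i
    simp [Pi.single_apply, eq_comm]
  rw [h2, h2]
  apply Complex.ext <;> simp <;> ring

theorem two_pow_dvd_of_forall_det_ne_zero {k : ℕ} {ι : Type} [Fintype ι] [DecidableEq ι]
    (hk : 1 ≤ k) (G : (Fin k ⊕ Fin k → ℝ) →ₗ[ℝ] Matrix ι ι ℝ)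
    (hG : ∀ v, v ≠ 0 → (G v).det ≠ 0) : 2 ^ k ∣ 2 * Fintype.card ι := by
  refine RealSymbol.IsElliptic.two_pow_dvd hk (f := RealSymbol.ofLinear G) fun v hv x hx => ?_
  rw [RealSymbol.eval_ofLinear] at hx
  by_contra hx0
  have h1 := Matrix.exists_mulVec_eq_zero_iff.mp ⟨x, hx0, hx⟩
  have h2 := (RingHom.map_det Complex.ofRealHom
    (G (Sum.elim (fun j => (v j).re) fun j => (v j).im))).trans h1
  refine hG _ (fun h0 => hv (funext fun j => Complex.ext ?_ ?_)) (Complex.ofReal_eq_zero.mp h2)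
  · simpa using congrFun h0 (Sum.inl j)
  · simpa using congrFun h0 (Sum.inr j)

theorem eq_of_two_pow_dvd {k : ℕ} (hk : 1 ≤ k) (h : 2 ^ k ∣ 2 * (k + k)) :
    k = 1 ∨ k = 2 ∨ k = 4 := by
  have h1 : ∀ n, 5 ≤ n → 4 * n < 2 ^ n := fun n hn => by
    induction n, hn using Nat.le_induction with
    | base => norm_num
    | succ n hn ih => rw [pow_succ]; omega
  have h2 : k ≤ 4 := by
    by_contra h3
    have := Nat.le_of_dvd (by omega) h
    have := h1 k (by omega)
    omega
  interval_cases k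
  · simp
  · simp
  · norm_num at h
  · simp

section DivisionAlgebra

variable {A : Type*} [NonUnitalNonAssocRing A] [Module ℝ A] [SMulCommClass ℝ A A]
  [IsScalarTower ℝ A A] {ι : Type*} [Fintype ι] [DecidableEq ι]

/-- The matrix of left multiplication by the vector with given coordinates. -/
noncomputable def Module.Basis.mulMatrix (B : Basis ι ℝ A) : (ι → ℝ) →ₗ[ℝ] Matrix ι ι ℝ :=
  (LinearMap.toMatrix B B).toLinearMap ∘ₗ LinearMap.mul ℝ A ∘ₗ B.equivFun.symm.toLinearMap

theorem Module.Basis.det_mulMatrix_ne_zero (B : Basis ι ℝ A)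
    (hdiv : ∀ x y : A, x * y = 0 → x = 0 ∨ y = 0) (v : ι → ℝ) (hv : v ≠ 0) :
    (B.mulMatrix v).det ≠ 0 := by
  have : FiniteDimensional ℝ A := B.finiteDimensional_of_finite
  have h1 : B.equivFun.symm v ≠ 0 := (map_ne_zero_iff _ (LinearEquiv.injective _)).mpr hv
  change (LinearMap.toMatrix B B (LinearMap.mul ℝ A (B.equivFun.symm v))).det ≠ 0
  rw [LinearMap.det_toMatrix]
  intro h2
  obtain ⟨y, hy, hy0⟩ :=
    Submodule.exists_mem_ne_zero_of_ne_bot (LinearMap.bot_lt_ker_of_det_eq_zero h2).ne'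
  exact (hdiv _ y hy).elim h1 hy0

end DivisionAlgebra

/-- Every finite-dimensional real division algebra has dimension 1, 2, 4 or 8. -/
theorem stmt_2 {A : Type*} [NonUnitalNonAssocRing A] [Module ℝ A]
    [SMulCommClass ℝ A A] [IsScalarTower ℝ A A] [FiniteDimensional ℝ A]
    [Nontrivial A] (hdiv : ∀ x y : A, x * y = 0 → x = 0 ∨ y = 0) :
    Module.finrank ℝ A ∈ ({1, 2, 4, 8} : Set ℕ) := by
  rcases Nat.lt_or_ge (finrank ℝ A) 2 with hn | hn
  · have : 0 < finrank ℝ A := finrank_pos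
    have : finrank ℝ A = 1 := by omega
    simp [this]
  · let B := finBasis ℝ A
    obtain ⟨k, hk⟩ := even_of_forall_det_ne_zero hn B.mulMatrix (B.det_mulMatrix_ne_zero hdiv)
    let B' : Basis (Fin k ⊕ Fin k) ℝ A :=
      (finBasisOfFinrankEq ℝ A hk).reindex finSumFinEquiv.symm
    have hk1 : 1 ≤ k := by omega
    have h1 := two_pow_dvd_of_forall_det_ne_zero hk1 B'.mulMatrix (B'.det_mulMatrix_ne_zero hdiv)
    rw [Fintype.card_sum, Fintype.card_fin] at h1
    rcases eq_of_two_pow_dvd hk1 h1 with rfl | rfl | rfl <;> simp [hk]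
end

section
/- If A is a real normed division algebra (a division algebra with identity equipped with an inner product satisfying ⟨xy, xy⟩ = ⟨x,x⟩⟨y,y⟩ for all x, y), then A is isomorphic to ℝ, ℂ, the quaternions ℍ, or the octonions 𝕆. -/
open scoped RealInnerProductSpace

/-- The octonions, constructed from the quaternions via the Cayley–Dickson
construction. -/
def Octo : Type := Quaternion ℝ × Quaternion ℝ

noncomputable instance : AddCommGroup Octo :=
  inferInstanceAs (AddCommGroup (Quaternion ℝ × Quaternion ℝ))

noncomputable instance : Module ℝ Octo :=
  inferInstanceAs (Module ℝ (Quaternion ℝ × Quaternion ℝ))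

/-- Cayley–Dickson multiplication on pairs of quaternions. -/
noncomputable instance : Mul Octo :=
  ⟨fun x y => show Quaternion ℝ × Quaternion ℝ from
    (Prod.fst x * Prod.fst y - star (Prod.snd y) * Prod.snd x,
     Prod.snd y * Prod.fst x + Prod.snd x * star (Prod.fst y))⟩

namespace CompositionAlgebra

variable {A : Type*} [NormedAddCommGroup A] [InnerProductSpace ℝ A]

/-- A bilinear product `m` with two-sided identity `e` for which the squared norm is
multiplicative. -/
structure IsComposition (m : A →ₗ[ℝ] A →ₗ[ℝ] A) (e : A) : Prop where
  one_mul : ∀ x, m e x = x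
  mul_one : ∀ x, m x e = x
  inner_one : ⟪e, e⟫ = 1
  inner_mul_self : ∀ x y, ⟪m x y, m x y⟫ = ⟪x, x⟫ * ⟪y, y⟫

/-- The conjugation `x ↦ 2⟪x, e⟫e - x`. -/
def conj (e x : A) : A := (2 * ⟪x, e⟫) • e - x

lemma inner_conj_left (e x y : A) : ⟪conj e x, y⟫ = ⟪x, conj e y⟫ := by
  simp only [conj, inner_sub_left, inner_sub_right, inner_smul_left, inner_smul_right,
    RCLike.conj_to_real, real_inner_comm e y]
  ring

lemma conj_of_inner_eq_zero {e x : A} (hx : ⟪x, e⟫ = 0) : conj e x = -x := by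
  simp [conj, hx]

namespace IsComposition

variable {m : A →ₗ[ℝ] A →ₗ[ℝ] A} {e : A}

lemma inner_mul_left (h : IsComposition m e) (x y z : A) : ⟪m x y, m x z⟫ = ⟪x, x⟫ * ⟪y, z⟫ := by
  have := h.inner_mul_self x (y + z)
  simp only [map_add, inner_add_left, inner_add_right, h.inner_mul_self] at this
  rw [real_inner_comm (m x y) (m x z), real_inner_comm y z] at this
  linarith

lemma inner_mul_right (h : IsComposition m e) (x y z : A) : ⟪m x z, m y z⟫ = ⟪x, y⟫ * ⟪z, z⟫ := by
  have := h.inner_mul_self (x + y) z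
  simp only [map_add, LinearMap.add_apply, inner_add_left, inner_add_right,
    h.inner_mul_self] at this
  rw [real_inner_comm (m x z) (m y z), real_inner_comm x y] at this
  linarith

lemma inner_exchange (h : IsComposition m e) (x y z w : A) :
    ⟪m x y, m z w⟫ + ⟪m x w, m z y⟫ = 2 * ⟪x, z⟫ * ⟪y, w⟫ := by
  have := h.inner_mul_right x z (y + w)
  simp only [map_add, inner_add_left, inner_add_right, h.inner_mul_right] at this
  rw [real_inner_comm y w] at this
  linarith

lemma inner_mul_eq_left (h : IsComposition m e) (x y z : A) : ⟪m x y, z⟫ = ⟪y, m (conj e x) z⟫ := by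
  have := h.inner_exchange x y e z
  simp only [h.one_mul] at this
  simp only [conj, map_sub, map_smul, LinearMap.sub_apply, LinearMap.smul_apply, h.one_mul,
    inner_sub_right, inner_smul_right]
  rw [real_inner_comm (m x z) y]
  linarith

lemma inner_mul_eq_right (h : IsComposition m e) (x y z : A) :
    ⟪m x y, z⟫ = ⟪x, m z (conj e y)⟫ := by
  have := h.inner_exchange x y z e
  simp only [h.mul_one] at this
  simp only [conj, map_sub, map_smul, h.mul_one, inner_sub_right, inner_smul_right]
  linarith

lemma conj_conj (h : IsComposition m e) (x : A) : conj e (conj e x) = x := by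
  simp only [conj, inner_sub_left, inner_smul_left, h.inner_one, RCLike.conj_to_real]
  module

lemma conj_mul (h : IsComposition m e) (x y : A) : conj e (m x y) = m (conj e y) (conj e x) := by
  refine ext_inner_right ℝ fun z => ?_
  rw [inner_conj_left, h.inner_mul_eq_left, h.inner_mul_eq_left (conj e y), h.conj_conj,
    real_inner_comm, h.inner_mul_eq_right, h.conj_conj]

lemma conj_mul_mul_add (h : IsComposition m e) (x y z : A) :
    m (conj e x) (m y z) + m (conj e y) (m x z) = (2 * ⟪x, y⟫) • z := by
  refine ext_inner_left ℝ fun t => ?_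
  have := h.inner_exchange x t y z
  rw [inner_add_right, ← h.inner_mul_eq_left, ← h.inner_mul_eq_left, inner_smul_right,
    real_inner_comm (m x z) (m y t)]
  linarith

lemma mul_mul_conj_add (h : IsComposition m e) (x y z : A) :
    m (m z x) (conj e y) + m (m z y) (conj e x) = (2 * ⟪x, y⟫) • z := by
  refine ext_inner_left ℝ fun t => ?_
  have := h.inner_exchange t y z x
  rw [inner_add_right, ← h.inner_mul_eq_right, ← h.inner_mul_eq_right, inner_smul_right,
    real_inner_comm y x]
  linarith

end IsComposition

/-- A subalgebra `S` containing the identity `e`, and a unit vector `i` orthogonal to it. -/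
structure IsDoubling (m : A →ₗ[ℝ] A →ₗ[ℝ] A) (e : A) (S : Submodule ℝ A) (i : A) : Prop
    extends IsComposition m e where
  one_mem : e ∈ S
  mul_mem : ∀ x ∈ S, ∀ y ∈ S, m x y ∈ S
  inner_unit : ⟪i, i⟫ = 1
  orthogonal : ∀ x ∈ S, ⟪x, i⟫ = 0

namespace IsDoubling

variable {m : A →ₗ[ℝ] A →ₗ[ℝ] A} {e : A} {S : Submodule ℝ A} {i : A} {a b c d : A}

lemma conj_mem (h : IsDoubling m e S i) (ha : a ∈ S) : conj e a ∈ S :=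
  S.sub_mem (S.smul_mem _ h.one_mem) ha

lemma inner_mul_unit (h : IsDoubling m e S i) (ha : a ∈ S) (hb : b ∈ S) : ⟪a, m b i⟫ = 0 := by
  rw [real_inner_comm, h.inner_mul_eq_left, real_inner_comm]
  exact h.orthogonal _ (h.mul_mem _ (h.conj_mem hb) _ ha)

lemma conj_unit (h : IsDoubling m e S i) : conj e i = -i :=
  conj_of_inner_eq_zero (by rw [real_inner_comm, h.orthogonal _ h.one_mem])

lemma conj_mul_unit (h : IsDoubling m e S i) (hb : b ∈ S) : conj e (m b i) = -m b i :=
  conj_of_inner_eq_zero (by rw [real_inner_comm, h.inner_mul_unit h.one_mem hb])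

lemma mul_unit_mul (h : IsDoubling m e S i) (b : A) (hc : c ∈ S) :
    m (m b i) c = m (m b (conj e c)) i := by
  have := h.mul_mul_conj_add i (conj e c) b
  rw [h.conj_conj, h.conj_unit, real_inner_comm, h.orthogonal _ (h.conj_mem hc), map_neg,
    mul_zero, zero_smul] at this
  exact add_neg_eq_zero.mp this

lemma unit_mul (h : IsDoubling m e S i) (hc : c ∈ S) : m i c = m (conj e c) i := by
  simpa only [h.one_mul] using h.mul_unit_mul e hc

lemma mul_mul_unit (h : IsDoubling m e S i) (ha : a ∈ S) (hd : d ∈ S) :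
    m a (m d i) = m (m d a) i := by
  have := h.conj_mul_mul_add (conj e a) i (conj e d)
  rw [h.conj_conj, h.conj_unit, h.orthogonal _ (h.conj_mem ha), h.unit_mul (h.conj_mem hd),
    h.conj_conj, mul_zero, zero_smul, map_neg, LinearMap.neg_apply,
    h.unit_mul (h.mul_mem _ (h.conj_mem ha) _ (h.conj_mem hd)), h.conj_mul, h.conj_conj,
    h.conj_conj] at this
  exact add_neg_eq_zero.mp this

lemma mul_unit_mul_unit (h : IsDoubling m e S i) (hb : b ∈ S) (hd : d ∈ S) :
    m (m b i) (m d i) = -m (conj e d) b := by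
  refine ext_inner_right ℝ fun t => ?_
  have h₁ := h.inner_exchange b i t (m d i)
  have h₂ : ⟪i, m d i⟫ = ⟪d, e⟫ := by
    have := h.inner_mul_right e d i
    rw [h.one_mul, h.inner_unit, mul_one] at this
    rw [this, real_inner_comm]
  rw [h₂, h.mul_mul_unit hb hd, h.inner_mul_right, h.inner_unit] at h₁
  rw [h.inner_mul_eq_right, h.conj_mul_unit hd, map_neg, inner_neg_right, inner_neg_left]
  simp only [conj, map_sub, map_smul, LinearMap.sub_apply, LinearMap.smul_apply, h.one_mul,
    inner_sub_left, inner_smul_left, RCLike.conj_to_real]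
  linarith

lemma mul_add_mul_unit (h : IsDoubling m e S i) (ha : a ∈ S) (hb : b ∈ S) (hc : c ∈ S)
    (hd : d ∈ S) :
    m (a + m b i) (c + m d i) =
      (m a c - m (conj e d) b) + m (m d a + m b (conj e c)) i := by
  simp only [map_add, LinearMap.add_apply, h.mul_unit_mul b hc, h.mul_mul_unit ha hd,
    h.mul_unit_mul_unit hb hd]
  abel

lemma conj_add_mul_unit (h : IsDoubling m e S i) (a : A) (hb : b ∈ S) :
    conj e (a + m b i) = conj e a - m b i := by
  have : ⟪m b i, e⟫ = 0 := by rw [real_inner_comm, h.inner_mul_unit h.one_mem hb]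
  simp only [conj, inner_add_left, this, add_zero]
  abel

lemma eq_zero_of_add_mul_unit (h : IsDoubling m e S i) (ha : a ∈ S) (hb : b ∈ S)
    (hab : a + m b i = 0) : a = 0 ∧ b = 0 := by
  have h₁ : ⟪a, a + m b i⟫ = 0 := by rw [hab, inner_zero_right]
  rw [inner_add_right, h.inner_mul_unit ha hb, add_zero, inner_self_eq_zero] at h₁
  rw [h₁, zero_add] at hab
  have h₂ := h.inner_mul_self b i
  rw [hab, h.inner_unit, mul_one, inner_zero_left] at h₂
  exact ⟨h₁, inner_self_eq_zero.mp h₂.symm⟩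

/-- A subalgebra admitting a doubling is associative. -/
lemma mul_assoc (h : IsDoubling m e S i) (ha : a ∈ S) (hc : c ∈ S) (hd : d ∈ S) :
    m (m d a) c = m d (m a c) := by
  have key : ∀ b ∈ S, ⟪m (m d a) c, b⟫ = ⟪m d (m a c), b⟫ := fun b hb => by
    have := h.inner_exchange a c (m b i) (m d i)
    rw [h.inner_mul_unit ha hb, h.mul_unit_mul_unit hb hd, h.mul_mul_unit ha hd,
      h.mul_unit_mul b hc, h.inner_mul_right, h.inner_unit, inner_neg_right] at this
    rw [h.inner_mul_eq_right (m d a), h.inner_mul_eq_left d (m a c)]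
    linarith
  have hmem : m (m d a) c - m d (m a c) ∈ S :=
    S.sub_mem (h.mul_mem _ (h.mul_mem _ hd _ ha) _ hc) (h.mul_mem _ hd _ (h.mul_mem _ ha _ hc))
  rw [← sub_eq_zero, ← inner_self_eq_zero (𝕜 := ℝ), inner_sub_left, key _ hmem, sub_self]

end IsDoubling

/-- An injective linear map that respects products and has the identity in its range. -/
structure IsEmbedding (m : A →ₗ[ℝ] A →ₗ[ℝ] A) (e : A) {D : Type*} [AddCommGroup D] [Module ℝ D]
    [Mul D] (f : D →ₗ[ℝ] A) : Prop where
  injective : Function.Injective f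
  map_mul : ∀ x y, f (x * y) = m (f x) (f y)
  one_mem : e ∈ LinearMap.range f

namespace IsEmbedding

variable {m : A →ₗ[ℝ] A →ₗ[ℝ] A} {e : A} {D : Type*} [AddCommGroup D] [Module ℝ D]
  {f : D →ₗ[ℝ] A}

lemma exists_equiv_or_isDoubling [Mul D] [FiniteDimensional ℝ A] (h : IsComposition m e)
    (hf : IsEmbedding m e f) :
    (∃ g : A ≃ₗ[ℝ] D, ∀ x y, g (m x y) = g x * g y) ∨
      ∃ i, IsDoubling m e (LinearMap.range f) i := by
  by_cases hS : LinearMap.range f = ⊤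
  · left
    let g := LinearEquiv.ofBijective f ⟨hf.injective, LinearMap.range_eq_top.mp hS⟩
    refine ⟨g.symm, fun x y => g.injective ?_⟩
    have hg : ∀ z, f (g.symm z) = z := g.apply_symm_apply
    change f _ = f _
    rw [hf.map_mul, hg, hg, hg]
  · right
    obtain ⟨v, hv, hv0⟩ := Submodule.exists_mem_ne_zero_of_ne_bot
      (mt (LinearMap.range f).orthogonal_eq_bot_iff.mp hS)
    refine ⟨‖v‖⁻¹ • v, h, hf.one_mem, ?_, ?_, fun x hx => ?_⟩
    · rintro _ ⟨x, rfl⟩ _ ⟨y, rfl⟩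
      exact ⟨x * y, hf.map_mul x y⟩
    · rw [real_inner_self_eq_norm_sq, norm_smul, norm_inv, norm_norm,
        inv_mul_cancel₀ (norm_ne_zero_iff.mpr hv0), one_pow]
    · rw [inner_smul_right, (Submodule.mem_orthogonal _ _).mp hv x hx, mul_zero]

/-- The doubled map `(a, b) ↦ f a + f b * i`. -/
def double (m : A →ₗ[ℝ] A →ₗ[ℝ] A) (f : D →ₗ[ℝ] A) (i : A) : D × D →ₗ[ℝ] A :=
  f.coprod (m.flip i ∘ₗ f)

lemma double_apply (i : A) (x : D × D) : double m f i x = f x.1 + m (f x.2) i := by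
  simp [double]

lemma map_double_mul [Mul D] [Star D] {i : A} (hf : IsEmbedding m e f)
    (hstar : ∀ x, f (star x) = conj e (f x)) (h : IsDoubling m e (LinearMap.range f) i)
    (x y : D × D) :
    double m f i (x.1 * y.1 - star y.2 * x.2, y.2 * x.1 + x.2 * star y.1) =
      m (double m f i x) (double m f i y) := by
  simp only [double_apply]
  rw [h.mul_add_mul_unit ⟨_, rfl⟩ ⟨_, rfl⟩ ⟨_, rfl⟩ ⟨_, rfl⟩]
  simp only [map_sub, map_add, hf.map_mul, hstar]

/-- Any algebra `E` that is linearly equivalent to the Cayley-Dickson double of `D` embeds. -/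
lemma doubling [Mul D] [Star D] {i : A} (hf : IsEmbedding m e f)
    (hstar : ∀ x, f (star x) = conj e (f x)) (h : IsDoubling m e (LinearMap.range f) i)
    {E : Type*} [AddCommGroup E] [Module ℝ E] [Mul E] (φ : E ≃ₗ[ℝ] D × D)
    (hφ : ∀ x y, φ (x * y) = ((φ x).1 * (φ y).1 - star (φ y).2 * (φ x).2,
      (φ y).2 * (φ x).1 + (φ x).2 * star (φ y).1)) :
    IsEmbedding m e (double m f i ∘ₗ φ.toLinearMap) where
  injective := by
    rw [LinearMap.coe_comp, LinearEquiv.coe_coe]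
    refine Function.Injective.comp (g := double m f i) ?_ φ.injective
    rw [injective_iff_map_eq_zero]
    intro x hx
    rw [double_apply] at hx
    have := h.eq_zero_of_add_mul_unit ⟨_, rfl⟩ ⟨_, rfl⟩ hx
    exact Prod.ext ((map_eq_zero_iff f hf.injective).mp this.1)
      ((map_eq_zero_iff f hf.injective).mp this.2)
  map_mul x y := by
    simp only [LinearMap.comp_apply, LinearEquiv.coe_coe, hφ]
    exact hf.map_double_mul hstar h _ _
  one_mem := by
    obtain ⟨u, hu⟩ := hf.one_mem
    exact ⟨φ.symm (u, 0), by simp [double_apply, hu]⟩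

lemma map_double_star [Star D] {i : A} (hstar : ∀ x, f (star x) = conj e (f x))
    (h : IsDoubling m e (LinearMap.range f) i) (x : D × D) :
    double m f i (star x.1, -x.2) = conj e (double m f i x) := by
  simp only [double_apply]
  rw [h.conj_add_mul_unit _ ⟨_, rfl⟩, hstar, map_neg, map_neg, LinearMap.neg_apply,
    sub_eq_add_neg]

end IsEmbedding

lemma IsComposition.isEmbedding_real {m : A →ₗ[ℝ] A →ₗ[ℝ] A} {e : A} (h : IsComposition m e) :
    IsEmbedding m e (LinearMap.toSpanSingleton ℝ A e) where
  injective := by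
    have he : e ≠ 0 := fun h0 => by simpa [h0] using h.inner_one
    exact smul_left_injective ℝ he
  map_mul x y := by simp [h.one_mul, mul_smul, smul_comm x y]
  one_mem := ⟨1, by simp⟩

lemma IsComposition.map_star_real {m : A →ₗ[ℝ] A →ₗ[ℝ] A} {e : A} (h : IsComposition m e)
    (x : ℝ) : LinearMap.toSpanSingleton ℝ A e (star x) =
      conj e (LinearMap.toSpanSingleton ℝ A e x) := by
  simp only [LinearMap.toSpanSingleton_apply, star_trivial, conj, inner_smul_left, h.inner_one,
    RCLike.conj_to_real]
  module

/-- A quaternion as a pair of complex numbers. -/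
def quaternionEquivProd : Quaternion ℝ ≃ₗ[ℝ] ℂ × ℂ where
  toFun q := (⟨q.re, q.imI⟩, ⟨q.imJ, q.imK⟩)
  invFun p := ⟨p.1.re, p.1.im, p.2.re, p.2.im⟩
  map_add' _ _ := rfl
  map_smul' _ _ := Prod.ext (Complex.ext (by simp) (by simp)) (Complex.ext (by simp) (by simp))
  left_inv _ := rfl
  right_inv _ := rfl

lemma quaternionEquivProd_apply (q : Quaternion ℝ) :
    quaternionEquivProd q = (⟨q.re, q.imI⟩, ⟨q.imJ, q.imK⟩) := rfl

lemma quaternionEquivProd_mul (x y : Quaternion ℝ) :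
    quaternionEquivProd (x * y) =
      ((quaternionEquivProd x).1 * (quaternionEquivProd y).1 -
          star (quaternionEquivProd y).2 * (quaternionEquivProd x).2,
        (quaternionEquivProd y).2 * (quaternionEquivProd x).1 +
          (quaternionEquivProd x).2 * star (quaternionEquivProd y).1) := by
  simp only [quaternionEquivProd_apply]
  refine Prod.ext (Complex.ext ?_ ?_) (Complex.ext ?_ ?_) <;> simp <;> ring

lemma quaternionEquivProd_star (x : Quaternion ℝ) :
    quaternionEquivProd (star x) =
      (star (quaternionEquivProd x).1, -(quaternionEquivProd x).2) := by
  simp only [quaternionEquivProd_apply]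
  refine Prod.ext (Complex.ext ?_ ?_) (Complex.ext ?_ ?_) <;> simp

/-- An octonion as a pair of quaternions. -/
noncomputable def octoEquivProd : Octo ≃ₗ[ℝ] Quaternion ℝ × Quaternion ℝ :=
  LinearEquiv.refl ℝ (Quaternion ℝ × Quaternion ℝ)

lemma octo_not_assoc : ∃ x y z : Octo, x * y * z ≠ x * (y * z) := by
  let i : Quaternion ℝ := ⟨0, 1, 0, 0⟩
  let j : Quaternion ℝ := ⟨0, 0, 1, 0⟩
  refine ⟨(i, 0), (j, 0), (0, 1), fun h => ?_⟩
  have h₁ : (1 : Quaternion ℝ) * (i * j - star 0 * 0) + (0 * i + 0 * star j) * star 0 =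
    (1 * j + 0 * star 0) * i + 0 * star (j * 0 - star 1 * 0) := congrArg Prod.snd h
  have h₂ := congrArg QuaternionAlgebra.imK h₁
  simp only [star_zero, mul_zero, zero_mul, add_zero, sub_zero, one_mul,
    Quaternion.imK_mul] at h₂
  norm_num [i, j] at h₂

/-- Hurwitz: a finite-dimensional real unital composition algebra with positive definite norm is
`ℝ`, `ℂ`, `ℍ` or `𝕆`. -/
theorem IsComposition.classification [FiniteDimensional ℝ A] {m : A →ₗ[ℝ] A →ₗ[ℝ] A} {e : A}
    (h : IsComposition m e) :
    (∃ g : A ≃ₗ[ℝ] ℝ, ∀ x y : A, g (m x y) = g x * g y) ∨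
    (∃ g : A ≃ₗ[ℝ] ℂ, ∀ x y : A, g (m x y) = g x * g y) ∨
    (∃ g : A ≃ₗ[ℝ] Quaternion ℝ, ∀ x y : A, g (m x y) = g x * g y) ∨
    (∃ g : A ≃ₗ[ℝ] Octo, ∀ x y : A, g (m x y) = g x * g y) := by
  refine (h.isEmbedding_real.exists_equiv_or_isDoubling h).imp_right ?_
  rintro ⟨i, hi⟩
  have hC := h.isEmbedding_real.doubling h.map_star_real hi Complex.equivRealProdLm
    (fun x y => by ext <;> simp <;> ring)
  have hCstar := fun z : ℂ => IsEmbedding.map_double_star h.map_star_real hi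
    (Complex.equivRealProdLm z)
  refine (hC.exists_equiv_or_isDoubling h).imp_right ?_
  rintro ⟨j, hj⟩
  have hH := hC.doubling hCstar hj quaternionEquivProd quaternionEquivProd_mul
  have hHstar := fun q : Quaternion ℝ => (congrArg _ (quaternionEquivProd_star q)).trans
    (IsEmbedding.map_double_star hCstar hj (quaternionEquivProd q))
  refine (hH.exists_equiv_or_isDoubling h).imp_right ?_
  rintro ⟨l, hl⟩
  have hO := hH.doubling hHstar hl octoEquivProd (fun x y => rfl)
  refine (hO.exists_equiv_or_isDoubling h).resolve_right ?_
  rintro ⟨k, hk⟩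
  obtain ⟨x, y, z, hxyz⟩ := octo_not_assoc
  refine hxyz (hO.injective ?_)
  rw [hO.map_mul, hO.map_mul, hO.map_mul, hO.map_mul]
  exact hk.mul_assoc ⟨_, rfl⟩ ⟨_, rfl⟩ ⟨_, rfl⟩

end CompositionAlgebra

/-- Every real normed division algebra (a division algebra with identity,
whose inner product satisfies ⟨xy,xy⟩ = ⟨x,x⟩⟨y,y⟩) is isomorphic to
ℝ, ℂ, the quaternions ℍ, or the octonions 𝕆. -/
theorem stmt_3 {A : Type*} [NormedAddCommGroup A] [InnerProductSpace ℝ A]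
    [FiniteDimensional ℝ A] [Mul A] [One A] [Nontrivial A]
    (hbil : ∀ (c : ℝ) (x y z : A),
      (c • x + y) * z = c • (x * z) + y * z ∧
      x * (c • y + z) = c • (x * y) + x * z)
    (hone : ∀ x : A, 1 * x = x ∧ x * 1 = x)
    (hdiv : ∀ x y : A, x * y = 0 → x = 0 ∨ y = 0)
    (hnorm : ∀ x y : A, ⟪x * y, x * y⟫ = ⟪x, x⟫ * ⟪y, y⟫) :
    (∃ e : A ≃ₗ[ℝ] ℝ, ∀ x y : A, e (x * y) = e x * e y) ∨
    (∃ e : A ≃ₗ[ℝ] ℂ, ∀ x y : A, e (x * y) = e x * e y) ∨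
    (∃ e : A ≃ₗ[ℝ] Quaternion ℝ, ∀ x y : A, e (x * y) = e x * e y) ∨
    (∃ e : A ≃ₗ[ℝ] Octo, ∀ x y : A, e (x * y) = e x * e y) := by
  have hadd : ∀ x y z : A, (x + y) * z = x * z + y * z := fun x y z => by
    simpa using (hbil 1 x y z).1
  have hadd' : ∀ x y z : A, x * (y + z) = x * y + x * z := fun x y z => by
    simpa using (hbil 1 x y z).2
  have hzero : ∀ z : A, (0 : A) * z = 0 := fun z => by simpa using hadd 0 0 z
  have hzero' : ∀ z : A, z * (0 : A) = 0 := fun z => by simpa using hadd' z 0 0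
  let m : A →ₗ[ℝ] A →ₗ[ℝ] A := LinearMap.mk₂ ℝ (fun x y => x * y) hadd
    (fun c x y => by simpa [hzero] using (hbil c x 0 y).1) hadd'
    (fun c x y => by simpa [hzero'] using (hbil c x y 0).2)
  have hone_ne : (1 : A) ≠ 0 := fun h0 => by
    obtain ⟨x, hx⟩ := exists_ne (0 : A)
    exact hx (by rw [← (hone x).1, h0, hzero])
  have h1 : ⟪(1 : A), 1⟫ = 1 := by
    have := hnorm 1 1
    rw [(hone 1).1] at this
    exact (mul_eq_left₀ (inner_self_ne_zero.mpr hone_ne)).mp this.symm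
  exact CompositionAlgebra.IsComposition.classification (m := m) (e := 1)
    ⟨fun x => (hone x).1, fun x => (hone x).2, h1, hnorm⟩
end
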